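/- arXiv:1602.07493 — 6 statements merged into one kernel-verified Lean document; each statement's English description precedes it below -/
import Mathlib

section
/- There exists a real-valued function η ∈ C^∞(ℝ) with the following properties: η(x) = 0 for x ≤ -1; η(x) = 1 for x ≥ 1; η'(x) > 0 for |x| < 1; the derivative η' is an even function; the function x ↦ √(η'(x)) is C^∞ on ℝ; and there exists a constant c > 0 such that η'(x) ≥ c·η(x) for all x ∈ (-1, 1/2]. -/
/-- Existence of the cutoff function `η`: a smooth real function with
`η = 0` on `(-∞,-1]`, `η = 1` on `[1,∞)`, `η' > 0` on `(-1,1)`, `η'` even, `√η'` smooth,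
and `η' ≥ c·η` on `(-1, 1/2]` for some `c > 0`. -/
theorem exists_eta_cutoff :
    ∃ η : ℝ → ℝ, ContDiff ℝ (⊤ : ℕ∞) η ∧
      (∀ x : ℝ, x ≤ -1 → η x = 0) ∧
      (∀ x : ℝ, 1 ≤ x → η x = 1) ∧
      (∀ x : ℝ, |x| < 1 → 0 < deriv η x) ∧
      (∀ x : ℝ, deriv η (-x) = deriv η x) ∧
      ContDiff ℝ (⊤ : ℕ∞) (fun x => Real.sqrt (deriv η x)) ∧
      ∃ c : ℝ, 0 < c ∧ ∀ x ∈ Set.Ioc (-1 : ℝ) (1 / 2), c * η x ≤ deriv η x := by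
  obtain ⟨k, hk⟩ : ∃ k : ℝ → ℝ, k = fun x => expNegInvGlue (1 - x ^ 2) := ⟨_, rfl⟩
  have hks : ContDiff ℝ (⊤ : ℕ∞) k := by
    rw [hk]
    exact expNegInvGlue.contDiff.comp (by fun_prop)
  have hk0 : ∀ x, 0 ≤ k x := fun x => by rw [hk]; exact expNegInvGlue.nonneg _
  have hkpos : ∀ x, |x| < 1 → 0 < k x := fun x hx => by
    rw [hk]
    apply expNegInvGlue.pos_of_pos
    have := (sq_lt_one_iff_abs_lt_one x).2 hx
    linarith
  have hkz : ∀ x, 1 ≤ |x| → k x = 0 := fun x hx => by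
    rw [hk]
    apply expNegInvGlue.zero_of_nonpos
    have := (one_le_sq_iff_one_le_abs x).2 hx
    linarith
  have hkm : ∀ s t, |s| ≤ |t| → k t ≤ k s := fun s t h => by
    rw [hk]
    apply expNegInvGlue.monotone
    have := sq_le_sq.2 h
    linarith
  have hke : ∀ x, k (-x) = k x := fun x => by simp [hk]
  have hkc : Continuous k := hks.continuous
  have hfc : Continuous fun x => k x ^ 2 := by fun_prop
  have hint : ∀ a b, IntervalIntegrable (fun x => k x ^ 2) MeasureTheory.volume a b :=
    fun a b => hfc.intervalIntegrable a b
  obtain ⟨I, hI⟩ : ∃ I : ℝ, I = ∫ t in (-1 : ℝ)..1, k t ^ 2 := ⟨_, rfl⟩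
  have hIpos : 0 < I := by
    rw [hI]
    apply intervalIntegral.intervalIntegral_pos_of_pos_on (hint _ _) _ (by norm_num)
    intro x hx
    have := hkpos x (abs_lt.2 hx)
    positivity
  have hd : ∀ x, HasDerivAt (fun x => (∫ t in (-1 : ℝ)..x, k t ^ 2) / I) (k x ^ 2 / I) x := by
    intro x
    exact (hfc.integral_hasStrictDerivAt (-1) x).hasDerivAt.div_const I
  have hde : deriv (fun x => (∫ t in (-1 : ℝ)..x, k t ^ 2) / I) = fun x => k x ^ 2 / I :=
    funext fun x => (hd x).deriv
  refine ⟨fun x => (∫ t in (-1 : ℝ)..x, k t ^ 2) / I, ?_, ?_, ?_, ?_, ?_, ?_, ?_⟩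
  · refine contDiff_infty_iff_deriv.2 ⟨fun x => (hd x).differentiableAt, ?_⟩
    rw [hde]
    exact (hks.pow 2).div_const I
  · intro x hx
    have : (∫ t in (-1 : ℝ)..x, k t ^ 2) = ∫ t in (-1 : ℝ)..x, (0 : ℝ) := by
      apply intervalIntegral.integral_congr
      intro t ht
      rw [Set.uIcc_of_ge hx] at ht
      have h1 : 1 ≤ |t| := le_abs.2 (Or.inr (by linarith [ht.2]))
      simp [hkz t h1]
    simp [this]
  · intro x hx
    have h2 : (∫ t in (1 : ℝ)..x, k t ^ 2) = ∫ t in (1 : ℝ)..x, (0 : ℝ) := by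
      apply intervalIntegral.integral_congr
      intro t ht
      rw [Set.uIcc_of_le hx] at ht
      have h1 : 1 ≤ |t| := le_abs.2 (Or.inl ht.1)
      simp [hkz t h1]
    have h3 := intervalIntegral.integral_add_adjacent_intervals (hint (-1) 1) (hint 1 x)
    rw [h2, ← hI] at h3
    simp only [intervalIntegral.integral_zero, add_zero] at h3
    simp only [← h3]
    exact div_self hIpos.ne'
  · intro x hx
    rw [hde]
    have := hkpos x hx
    positivity
  · intro x
    rw [hde]
    simp only [hke]
  · rw [hde]
    have : (fun x => Real.sqrt (k x ^ 2 / I)) = fun x => k x / Real.sqrt I := by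
      funext x
      rw [Real.sqrt_div (sq_nonneg _), Real.sqrt_sq (hk0 x)]
    rw [this]
    exact hks.div_const _
  · have hh : 0 < k (1 / 2) := hkpos _ (by rw [abs_of_pos] <;> norm_num)
    have h0 : 0 < k 0 := hkpos _ (by simp)
    have h0h : k (1 / 2) ≤ k 0 := hkm _ _ (by simp)
    obtain ⟨C, hC⟩ : ∃ C : ℝ, C = k 0 / k (1 / 2) := ⟨_, rfl⟩
    have hC1 : 1 ≤ C := by rw [hC]; exact (one_le_div hh).2 h0h
    have hCk : C * k (1 / 2) = k 0 := by rw [hC]; field_simp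
    refine ⟨1 / (2 * C ^ 2), by positivity, ?_⟩
    intro x hx
    rw [hde]
    have key : ∀ t ∈ Set.Icc (-1) x, k t ^ 2 ≤ C ^ 2 * k x ^ 2 := by
      intro t ht
      rw [← mul_pow]
      apply pow_le_pow_left₀ (hk0 t)
      rcases le_or_gt |x| |t| with h | h
      · have := hkm _ _ h
        nlinarith [hk0 x]
      · have hx0 : 0 ≤ x := by
          by_contra hn
          push Not at hn
          rw [abs_of_neg hn, abs_of_neg (by linarith [ht.2])] at h
          linarith [ht.2]
        have e1 : k t ≤ k 0 := hkm _ _ (by simp)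
        have e2 : k (1 / 2) ≤ k x := hkm _ _ (by
          rw [abs_of_nonneg hx0, abs_of_pos (by norm_num)]; exact hx.2)
        nlinarith
    have hle : (∫ t in (-1 : ℝ)..x, k t ^ 2) ≤ ∫ t in (-1 : ℝ)..x, C ^ 2 * k x ^ 2 :=
      intervalIntegral.integral_mono_on hx.1.le (hint _ _) (by simp) key
    rw [intervalIntegral.integral_const, smul_eq_mul] at hle
    have hle2 : (∫ t in (-1 : ℝ)..x, k t ^ 2) ≤ 2 * C ^ 2 * k x ^ 2 := by
      have : 0 ≤ C ^ 2 * k x ^ 2 := by positivity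
      nlinarith [hx.2]
    show 1 / (2 * C ^ 2) * ((∫ t in (-1 : ℝ)..x, k t ^ 2) / I) ≤ k x ^ 2 / I
    rw [← mul_div_assoc]
    apply div_le_div_of_nonneg_right _ hIpos.le
    rw [one_div, inv_mul_le_iff₀ (by positivity)]
    exact hle2
end

section
/- Let η : ℝ → ℝ be continuously differentiable with η(x) = 0 for x ≤ -1, η(x) = 1 for x ≥ 1, η'(x) ≥ 0 for all x, η' even, and suppose there is c > 0 with η'(x) ≥ c·η(x) for all x ∈ (-1, 1/2]. Let σ > 0 and let ε > 0 satisfy ε² ≤ (2/3)·c·σ. Define ζ_ε(b) = η_ε(b) - η_ε(-b). Then for all b ∈ ℝ: b·ζ_ε(b) + σ·(η_ε'(b) + η_ε'(-b)) ≥ 1/2. -/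
theorem zlb_core (η : ℝ → ℝ) (hη : ContDiff ℝ 1 η)
    (h0 : ∀ x : ℝ, x ≤ -1 → η x = 0)
    (h1 : ∀ x : ℝ, 1 ≤ x → η x = 1)
    (hpos : ∀ x : ℝ, 0 ≤ deriv η x)
    (heven : ∀ x : ℝ, deriv η (-x) = deriv η x)
    (c : ℝ) (hc : 0 < c)
    (hcη : ∀ x ∈ Set.Ioc (-1 : ℝ) (1 / 2), c * η x ≤ deriv η x)
    (s : ℝ) (hs : 3 / 2 ≤ s * c) (y : ℝ) (hy : 0 ≤ y) :
    1 / 2 ≤ y * (η y - η (-y)) + s * (2 * deriv η y) := by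
  have hd : Differentiable ℝ η := hη.differentiable (by norm_num)
  have hmono : Monotone η := monotone_of_deriv_nonneg hd hpos
  have hder : ∀ x, HasDerivAt (fun x => η x + η (-x)) 0 x := by
    intro x
    have h2 : HasDerivAt (fun x => η (-x)) (deriv η (-x) * (-1)) x :=
      (hd (-x)).hasDerivAt.comp x (hasDerivAt_neg x)
    have h3 := (hd x).hasDerivAt.add h2
    rw [heven] at h3
    exact h3.congr_deriv (by ring)
  have hsum : η y + η (-y) = 1 := by
    have h := is_const_of_deriv_eq_zero (fun x => (hder x).differentiableAt)
      (fun x => (hder x).deriv) y 1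
    change η y + η (-y) = η 1 + η (-1) at h
    rw [h, h1 1 le_rfl, h0 (-1) le_rfl]; norm_num
  have hs0 : 0 < s := by
    by_contra hn
    push Not at hn
    nlinarith [mul_nonneg (neg_nonneg.mpr hn) hc.le]
  have hle : η (-y) ≤ η y := hmono (by linarith)
  have hn0 : 0 ≤ η (-y) := by
    rcases le_total (-1) (-y) with h | h
    · have := hmono h
      rwa [h0 (-1) le_rfl] at this
    · exact (h0 _ h).ge
  have hd0 : 0 ≤ s * (2 * deriv η y) := by have := hpos y; positivity
  rcases le_or_gt y (1 / 2) with h | h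
  · have h2 := mul_le_mul_of_nonneg_left (hcη y ⟨by linarith, h⟩) hs0.le
    have h3 : 3 / 2 * η y ≤ s * c * η y := mul_le_mul_of_nonneg_right hs (by linarith)
    have h4 : 0 ≤ y * (η y - η (-y)) := mul_nonneg hy (by linarith)
    nlinarith
  · rcases lt_or_ge y 1 with h' | h'
    · have h2 := mul_le_mul_of_nonneg_left (hcη (-y) ⟨by linarith, by linarith⟩) hs0.le
      rw [heven] at h2
      have h3 : 3 / 2 * η (-y) ≤ s * c * η (-y) := mul_le_mul_of_nonneg_right hs hn0
      have h4 : 1 / 2 * (η y - η (-y)) ≤ y * (η y - η (-y)) :=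
        mul_le_mul_of_nonneg_right h.le (by linarith)
      nlinarith
    · rw [h1 y h', h0 (-y) (by linarith)]
      linarith

/-- With `ζ_ε(b) = η_ε(b) - η_ε(-b)`, if `ε² ≤ (2/3)·c·σ` then
`b·ζ_ε(b) + σ·(η_ε'(b) + η_ε'(-b)) ≥ 1/2` for all `b ∈ ℝ`, where `η_ε(x) = ε⁻¹ η(x/ε)` and
`η_ε'(x) = ε⁻² η'(x/ε)`. -/
theorem zeta_lower_bound (η : ℝ → ℝ) (hη : ContDiff ℝ 1 η)
    (h0 : ∀ x : ℝ, x ≤ -1 → η x = 0)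
    (h1 : ∀ x : ℝ, 1 ≤ x → η x = 1)
    (hpos : ∀ x : ℝ, 0 ≤ deriv η x)
    (heven : ∀ x : ℝ, deriv η (-x) = deriv η x)
    (c : ℝ) (hc : 0 < c)
    (hcη : ∀ x ∈ Set.Ioc (-1 : ℝ) (1 / 2), c * η x ≤ deriv η x)
    (σ ε : ℝ) (hσ : 0 < σ) (hε : 0 < ε) (hε2 : ε ^ 2 ≤ 2 / 3 * c * σ) :
    ∀ b : ℝ, 1 / 2 ≤
      b * (ε⁻¹ * η (b / ε) - ε⁻¹ * η (-b / ε)) +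
        σ * ((ε ^ 2)⁻¹ * deriv η (b / ε) + (ε ^ 2)⁻¹ * deriv η (-b / ε)) := by
  intro b
  have hs : 3 / 2 ≤ σ * (ε ^ 2)⁻¹ * c := by
    have : σ * (ε ^ 2)⁻¹ * c = σ * c / ε ^ 2 := by ring
    rw [this, le_div_iff₀ (by positivity)]
    linarith
  have key := zlb_core η hη h0 h1 hpos heven c hc hcη _ hs
  have e : b * (ε⁻¹ * η (b / ε) - ε⁻¹ * η (-b / ε)) +
        σ * ((ε ^ 2)⁻¹ * deriv η (b / ε) + (ε ^ 2)⁻¹ * deriv η (-b / ε)) =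
      (b / ε) * (η (b / ε) - η (-(b / ε))) + σ * (ε ^ 2)⁻¹ * (2 * deriv η (b / ε)) := by
    rw [neg_div, heven]
    ring
  rw [e]
  rcases le_total 0 (b / ε) with h | h
  · exact key _ h
  · have := key (-(b / ε)) (by linarith)
    rw [heven, neg_neg] at this
    linarith
end

section
/- For every compactly supported smooth function F : ℝ → ℂ there exists an almost analytic extension of F, i.e. a compactly supported smooth function F̃ : ℂ → ℂ (smooth as a function of the two real variables u, v where z = u + iv) with F̃(x) = F(x) for all real x, such that for every k ∈ ℕ there is a constant C_k with |(∂̄F̃)(z)| ≤ C_k |Im z|^k for all z ∈ ℂ. -/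
/-- The Cauchy–Riemann operator `∂̄ = (1/2)(∂_u + i ∂_v)` acting on functions of
`z = u + iv ∈ ℂ`, viewed as smooth functions of the two real variables `u, v`. -/
noncomputable def dbar (f : ℂ → ℂ) (z : ℂ) : ℂ :=
  (1 / 2) * (fderiv ℝ f z 1 + Complex.I * fderiv ℝ f z Complex.I)

open MeasureTheory Filter Topology Complex

open scoped FourierTransform SchwartzMap ContDiff

/-- Rapid decay of a kernel: all moments are integrable. -/
def RapidK (φ : ℝ → ℂ) : Prop := ∀ n : ℕ, Integrable (fun t : ℝ => (t : ℂ) ^ n * φ t)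

/-- The averaged extension. -/
noncomputable def avgExt (F φ : ℝ → ℂ) (z : ℂ) : ℂ := ∫ t : ℝ, F (z.re + z.im * t) * φ t

theorem RapidK.shift {φ : ℝ → ℂ} (h : RapidK φ) : RapidK (fun t : ℝ => (t : ℂ) * φ t) := by
  intro n
  refine (h (n + 1)).congr (Eventually.of_forall fun t => ?_)
  simp only [pow_succ, mul_assoc]

theorem RapidK.int {φ : ℝ → ℂ} (h : RapidK φ) : Integrable φ := by
  simpa using h 0

theorem exists_bd {F : ℝ → ℂ} (hF : ContDiff ℝ ∞ F) (hs : HasCompactSupport F) :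
    ∃ C : ℝ, ∀ x, ‖F x‖ ≤ C := hF.continuous.bounded_above_of_compact_support hs |>.imp
      fun _ h => h

theorem avg_integrable {F φ : ℝ → ℂ} (hF : ContDiff ℝ ∞ F) (hs : HasCompactSupport F)
    (hφ : RapidK φ) (z : ℂ) : Integrable (fun t : ℝ => F (z.re + z.im * t) * φ t) := by
  obtain ⟨C, hC⟩ := exists_bd hF hs
  have hc := hF.continuous
  refine hφ.int.bdd_mul (c := C) ?_ (Eventually.of_forall fun t => hC _)
  exact Continuous.aestronglyMeasurable (by fun_prop)

theorem smooth_deriv {F : ℝ → ℂ} (hF : ContDiff ℝ ∞ F) : ContDiff ℝ ∞ (deriv F) :=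
  (contDiff_infty_iff_deriv.1 hF).2

theorem avg_hasFDerivAt {F φ : ℝ → ℂ} (hF : ContDiff ℝ ∞ F) (hs : HasCompactSupport F)
    (hφ : RapidK φ) (z : ℂ) :
    HasFDerivAt (avgExt F φ)
      (reCLM.smulRight (avgExt (deriv F) φ z) +
        imCLM.smulRight (avgExt (deriv F) (fun t : ℝ => (t : ℂ) * φ t) z)) z := by
  have hF' := smooth_deriv hF
  have hs' : HasCompactSupport (deriv F) := hs.deriv
  obtain ⟨C, hC⟩ := exists_bd hF' hs'
  have i1 := fun z => avg_integrable hF' hs' hφ z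
  have i2 := fun z => avg_integrable hF' hs' hφ.shift z
  let D : ℂ → ℝ → ℂ →L[ℝ] ℂ := fun z t =>
    reCLM.smulRight (deriv F (z.re + z.im * t) * φ t) +
      imCLM.smulRight (deriv F (z.re + z.im * t) * ((t : ℂ) * φ t))
  have iD1 : ∀ z : ℂ, Integrable (fun t : ℝ => 
    reCLM.smulRight (deriv F (z.re + z.im * t) * φ t)) := fun z =>
      (ContinuousLinearMap.smulRightL ℝ ℂ ℂ reCLM).integrable_comp (i1 z)
  have iD2 : ∀ z : ℂ, Integrable (fun t : ℝ => 
    imCLM.smulRight (deriv F (z.re + z.im * t) * ((t : ℂ) * φ t))) := fun z =>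
      (ContinuousLinearMap.smulRightL ℝ ℂ ℂ imCLM).integrable_comp (i2 z)
  have hDm : AEStronglyMeasurable (D z) volume := by
    have := (iD1 z).1.add (iD2 z).1
    exact this
  have key : HasFDerivAt (avgExt F φ) (∫ t, D z t) z := by
    refine hasFDerivAt_integral_of_dominated_of_fderiv_le (s := Set.univ) (F' := D)
      (bound := fun t => C * ‖φ t‖ + C * ‖(t : ℂ) * φ t‖) univ_mem
      (Eventually.of_forall fun w => (avg_integrable hF hs hφ w).1)
      (avg_integrable hF hs hφ z) hDm ?_ ?_ ?_
    · refine Eventually.of_forall fun t w _ => ?_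
      refine (norm_add_le _ _).trans ?_
      rw [ContinuousLinearMap.norm_smulRight_apply, ContinuousLinearMap.norm_smulRight_apply,
        reCLM_norm, imCLM_norm, one_mul, one_mul, norm_mul, norm_mul _ ((t : ℂ) * φ t)]
      gcongr <;> exact hC _
    · exact (hφ.int.norm.const_mul C).add (hφ.shift.int.norm.const_mul C)
    · refine Eventually.of_forall fun t w _ => ?_
      have h1 : HasFDerivAt (fun w : ℂ => w.re + w.im * t) (reCLM + t • imCLM) w := by
        refine (reCLM.hasFDerivAt (x := w)).add ?_
        exact (imCLM.hasFDerivAt (x := w)).mul_const t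
      have h2 : HasDerivAt F (deriv F (w.re + w.im * t)) (w.re + w.im * t) :=
        ((hF.differentiable (by simp)) _).hasDerivAt
      have h3 := (h2.hasFDerivAt.comp w h1).mul_const (φ t)
      refine h3.congr_fderiv ?_
      ext v <;> simp [D] <;> ring
  refine key.congr_fderiv ?_
  rw [integral_add (iD1 z) (iD2 z)]
  congr 1
  · exact (ContinuousLinearMap.smulRightL ℝ ℂ ℂ reCLM).integral_comp_comm (i1 z)
  · exact (ContinuousLinearMap.smulRightL ℝ ℂ ℂ imCLM).integral_comp_comm (i2 z)

theorem avg_contDiff_nat (n : ℕ) : ∀ {F φ : ℝ → ℂ}, ContDiff ℝ ∞ F → HasCompactSupport F →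
    RapidK φ → ContDiff ℝ n (avgExt F φ) := by
  induction n with
  | zero =>
    intro F φ hF hs hφ
    refine contDiff_zero.2 (continuous_iff_continuousAt.2 fun z => 
      (avg_hasFDerivAt hF hs hφ z).continuousAt)
  | succ n ih =>
    intro F φ hF hs hφ
    push_cast
    refine contDiff_succ_iff_hasFDerivAt.2 ⟨_, ?_, fun z => avg_hasFDerivAt hF hs hφ z⟩
    refine ContDiff.add ?_ ?_
    · exact (ContinuousLinearMap.smulRightL ℝ ℂ ℂ reCLM).contDiff.comp
        (ih (smooth_deriv hF) hs.deriv hφ)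
    · exact (ContinuousLinearMap.smulRightL ℝ ℂ ℂ imCLM).contDiff.comp
        (ih (smooth_deriv hF) hs.deriv hφ.shift)

theorem avg_contDiff {F φ : ℝ → ℂ} (hF : ContDiff ℝ ∞ F) (hs : HasCompactSupport F)
    (hφ : RapidK φ) : ContDiff ℝ ∞ (avgExt F φ) :=
  contDiff_infty.2 fun n => avg_contDiff_nat n hF hs hφ

theorem avg_real (F φ : ℝ → ℂ) (z : ℂ) (hz : z.im = 0) :
    avgExt F φ z = F z.re * ∫ t, φ t := by
  simp [avgExt, hz, integral_const_mul]

theorem avg_decay (k : ℕ) (S : Set ℝ) : ∀ {F φ : ℝ → ℂ}, ContDiff ℝ ∞ F → HasCompactSupport F →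
    RapidK φ →
    (∀ n : ℕ, ∀ x ∈ S, iteratedDeriv n F x * ∫ t : ℝ, (t : ℂ) ^ n * φ t = 0) →
    ∃ C : ℝ, 0 ≤ C ∧ ∀ z : ℂ, z.re ∈ S → ‖avgExt F φ z‖ ≤ C * |z.im| ^ k := by
  induction k with
  | zero =>
    intro F φ hF hs hφ _
    obtain ⟨C, hC⟩ := exists_bd hF hs
    have hC0 : 0 ≤ C := (norm_nonneg _).trans (hC 0)
    refine ⟨C * ∫ t, ‖φ t‖, by positivity, fun z _ => ?_⟩
    rw [pow_zero, mul_one, ← integral_const_mul]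
    refine norm_integral_le_of_norm_le (hφ.int.norm.const_mul C) (Eventually.of_forall fun t => ?_)
    rw [norm_mul]
    gcongr
    exact hC _
  | succ k ih =>
    intro F φ hF hs hφ hm
    obtain ⟨C, hC0, hC⟩ := ih (smooth_deriv hF) hs.deriv hφ.shift (by
      intro n x hx
      have := hm (n + 1) x hx
      rw [iteratedDeriv_succ'] at this
      simpa only [pow_succ, mul_assoc] using this)
    refine ⟨C, hC0, fun z hz => ?_⟩
    let p : ℝ → ℂ := fun s => (z.re : ℂ) + s • ((z.im : ℂ) * I)
    have hpre : ∀ s, (p s).re = z.re := by intro s; simp [p]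
    have hpim : ∀ s, (p s).im = s * z.im := by intro s; simp [p]
    have hp : ∀ s, HasDerivAt p ((z.im : ℂ) * I) s := by
      intro s
      have := ((hasDerivAt_id s).smul_const ((z.im : ℂ) * I)).const_add (z.re : ℂ)
      rw [one_smul] at this
      exact this
    have hd : ∀ s, HasDerivAt (fun s => avgExt F φ (p s))
        (z.im • avgExt (deriv F) (fun t : ℝ => (t : ℂ) * φ t) (p s)) s := by
      intro s
      have := (avg_hasFDerivAt hF hs hφ (p s)).comp_hasDerivAt s (hp s)
      refine this.congr_deriv ?_
      simp
    have h01 := norm_image_sub_le_of_norm_deriv_le_segment_01'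
      (C := C * |z.im| ^ (k + 1)) (fun s _ => (hd s).hasDerivWithinAt) (by
        intro s hs
        rw [norm_smul, Real.norm_eq_abs, pow_succ, ← mul_assoc, mul_comm]
        gcongr
        refine (hC (p s) (by rwa [hpre])).trans ?_
        rw [hpim]
        refine mul_le_mul_of_nonneg_left (pow_le_pow_left₀ (abs_nonneg _) ?_ k) hC0
        rw [abs_mul, abs_of_nonneg hs.1]
        exact mul_le_of_le_one_left (abs_nonneg _) hs.2.le)
    have hp1 : p 1 = z := by simp [p]
    have hp0 : avgExt F φ (p 0) = 0 := by
      rw [avg_real _ _ _ (by simp [hpim]), hpre]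
      simpa using hm 0 _ hz
    simpa only [hp1, hp0, sub_zero] using h01

theorem exists_kernel : ∃ φ : ℝ → ℂ, RapidK φ ∧ ∀ n : ℕ, ∫ t : ℝ, (t : ℂ) ^ n * φ t = I ^ n := by
  let b : ContDiffBump (0 : ℝ) := ⟨1, 2, by norm_num, by norm_num⟩
  let g : ℝ → ℂ := fun s => (b s : ℂ) * cexp (2 * Real.pi * s)
  have hg1 : HasCompactSupport g := by
    refine HasCompactSupport.mul_right ?_
    exact b.hasCompactSupport.comp_left (g := fun x : ℝ => (x : ℂ)) (by simp)
  have hg2 : ContDiff ℝ ∞ g := by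
    refine ContDiff.mul (ofRealCLM.contDiff.comp b.contDiff) ?_
    refine ContDiff.cexp ?_
    exact contDiff_const.mul ofRealCLM.contDiff
  let gS : 𝓢(ℝ, ℂ) := hg1.toSchwartzMap hg2
  let φ : 𝓢(ℝ, ℂ) := 𝓕⁻ gS
  have hR : ∀ n : ℕ, Integrable (fun t : ℝ => t ^ n • φ t) := by
    intro n
    have := φ.integrable_pow_mul volume n
    refine this.mono' (Continuous.aestronglyMeasurable (by fun_prop)) 
      (Eventually.of_forall fun t => ?_)
    simp
  have hRK : RapidK φ := by
    intro n
    simpa using hR n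
  have hFou : 𝓕 (φ : ℝ → ℂ) = g := by
    rw [← SchwartzMap.fourier_coe]
    have : 𝓕 φ = gS := by simp [φ]
    rw [this]
    rfl
  refine ⟨φ, hRK, fun n => ?_⟩
  have h1 := congrFun (Real.iteratedDeriv_fourier (f := φ) (N := ⊤) (n := n)
    (fun n _ => hR n) le_top) 0
  rw [hFou] at h1
  have h2 : iteratedDeriv n g 0 = (2 * Real.pi) ^ n := by
    have he : g =ᶠ[𝓝 0] fun s : ℝ => cexp (2 * Real.pi * s) := by
      filter_upwards [b.eventuallyEq_one] with s hs
      simp [g, hs]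
    rw [he.iteratedDeriv_eq]
    have : ∀ n : ℕ, iteratedDeriv n (fun s : ℝ => cexp (2 * Real.pi * s)) =
        fun s : ℝ => (2 * Real.pi : ℂ) ^ n * cexp (2 * Real.pi * s) := by
      intro n
      induction n with
      | zero => simp
      | succ n ih =>
        rw [iteratedDeriv_succ, ih]
        funext s
        have hd : HasDerivAt (fun s : ℝ => cexp (2 * Real.pi * s))
            (cexp (2 * Real.pi * s) * (2 * Real.pi * 1)) s :=
          ((ofRealCLM.hasDerivAt (x := s)).const_mul (2 * Real.pi : ℂ)).cexp
        rw [(hd.const_mul _).deriv]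
        ring
    rw [this]
    simp
  rw [h2, Real.fourier_eq] at h1
  have h3 : ∀ v : ℝ, (-2 * Real.pi * I * v) ^ n • φ v 
      = (-2 * Real.pi * I) ^ n * ((v : ℂ) ^ n * φ v) := by
    intro v
    rw [smul_eq_mul, mul_pow _ (v : ℂ), mul_assoc]
  simp only [inner_zero_right, neg_zero, AddChar.map_zero_eq_one, one_smul, h3,
    integral_const_mul] at h1
  have hne : (-2 * Real.pi * I : ℂ) ^ n ≠ 0 := by
    apply pow_ne_zero
    simp [Real.pi_ne_zero]
  apply mul_left_cancel₀ hne
  rw [← h1, ← mul_pow]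
  congr 1
  linear_combination (-2 * Real.pi : ℂ) * (-I_mul_I)

/-- Every compactly supported smooth `F : ℝ → ℂ` admits an almost analytic
extension: a compactly supported smooth `F̃ : ℂ → ℂ` with `F̃|ℝ = F` and, for every `k`,
`|∂̄F̃(z)| ≤ C_k |Im z|^k`. -/
theorem exists_almost_analytic_extension (F : ℝ → ℂ)
    (hF : ContDiff ℝ (⊤ : ℕ∞) F) (hFsupp : HasCompactSupport F) :
    ∃ Ftil : ℂ → ℂ, ContDiff ℝ (⊤ : ℕ∞) Ftil ∧ HasCompactSupport Ftil ∧
      (∀ x : ℝ, Ftil (x : ℂ) = F x) ∧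
      ∀ k : ℕ, ∃ C : ℝ, ∀ z : ℂ, ‖dbar Ftil z‖ ≤ C * |z.im| ^ k := by
  obtain ⟨φ, hφ, hmom⟩ := exists_kernel
  set G := avgExt F φ with hG
  have hGc : ContDiff ℝ ∞ G := avg_contDiff hF hFsupp hφ
  obtain ⟨R, hR0, hR⟩ : ∃ R : ℝ, 0 ≤ R ∧ ∀ x ∈ tsupport F, |x| ≤ R := by
    obtain ⟨R, hR⟩ := hFsupp.isCompact.isBounded.exists_norm_le
    exact ⟨max R 0, le_max_right _ _, fun x hx => (hR x hx).trans (le_max_left _ _)⟩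
  let b : ContDiffBump (0 : ℂ) := ⟨R + 1, R + 2, by positivity, by linarith⟩
  let χ : ℂ → ℂ := fun z => (b z : ℂ)
  have hχ : ContDiff ℝ ∞ χ := ofRealCLM.contDiff.comp b.contDiff
  have hχs : HasCompactSupport χ :=
    b.hasCompactSupport.comp_left (g := fun x : ℝ => (x : ℂ)) (by simp)
  have hχ1 : ∀ z : ℂ, ‖z‖ ≤ R + 1 → χ z = 1 := by
    intro z hz
    have := b.one_of_mem_closedBall (x := z) (by simpa [b] using hz)
    simp [χ, this]
  have hGdb : ∀ z, dbar G z = (1 / 2) * 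
      avgExt (deriv F) (fun t : ℝ => (1 + I * t) * φ t) z := by
    intro z
    have h := (avg_hasFDerivAt hF hFsupp hφ z).fderiv
    have hadd : avgExt (deriv F) (fun t : ℝ => (1 + I * t) * φ t) z =
        avgExt (deriv F) φ z + I * avgExt (deriv F) (fun t : ℝ => (t : ℂ) * φ t) z := by
      unfold avgExt
      rw [← integral_const_mul, ← integral_add]
      · congr 1; funext t; ring
      · exact avg_integrable (smooth_deriv hF) hFsupp.deriv hφ z
      · exact (avg_integrable (smooth_deriv hF) hFsupp.deriv hφ.shift z).const_mul _
    rw [dbar, hG, h, hadd]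
    simp
  have hψ : RapidK (fun t : ℝ => (1 + I * t) * φ t) := by
    intro n
    refine ((hφ n).add ((hφ (n + 1)).const_mul I)).congr (Eventually.of_forall fun t => ?_)
    simp only [Pi.add_apply]
    ring
  have hψm : ∀ n : ℕ, ∫ t : ℝ, (t : ℂ) ^ n * ((1 + I * t) * φ t) = 0 := by
    intro n
    have : ∀ t : ℝ, (t : ℂ) ^ n * ((1 + I * t) * φ t) =
        (t : ℂ) ^ n * φ t + I * ((t : ℂ) ^ (n + 1) * φ t) := by intro t; ring
    simp only [this]
    rw [integral_add (hφ n) ((hφ (n + 1)).const_mul I), integral_const_mul, hmom, hmom, pow_succ]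
    linear_combination I ^ n * I_mul_I
  have hprod : ∀ z, dbar (fun z => χ z * G z) z = χ z * dbar G z + G z * dbar χ z := by
    intro z
    have h1 : DifferentiableAt ℝ χ z := hχ.differentiable (by simp) z
    have h2 : DifferentiableAt ℝ G z := hGc.differentiable (by simp) z
    rw [dbar, fderiv_fun_mul h1 h2]
    simp [dbar]
    ring
  obtain ⟨M, hM⟩ : ∃ M : ℝ, ∀ z, ‖dbar χ z‖ ≤ M := by
    have hc : Continuous (fderiv ℝ χ) := hχ.continuous_fderiv (by simp)
    refine Continuous.bounded_above_of_compact_support (f := dbar χ) ?_ ?_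
    · unfold dbar; fun_prop
    · refine (hχs.fderiv ℝ).mono' ?_
      refine Function.support_subset_iff'.2 (fun z hz => ?_) |>.trans (subset_refl _)
      simp [dbar, image_eq_zero_of_notMem_tsupport hz]
  have hM0 : 0 ≤ M := (norm_nonneg _).trans (hM 0)
  have hχle : ∀ z, ‖χ z‖ ≤ 1 := by
    intro z
    simp only [χ, norm_real, Real.norm_eq_abs, abs_of_nonneg b.nonneg]
    exact b.le_one
  refine ⟨fun z => χ z * G z, hχ.mul hGc, hχs.mul_right, ?_, ?_⟩
  · intro x
    have hm0 : ∫ t, φ t = 1 := by simpa using hmom 0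
    have hGx : G x = F x := by
      rw [hG, avg_real _ _ _ (ofReal_im x), hm0]; simp
    by_cases hx : x ∈ tsupport F
    · have := hR x hx
      simp only [hGx]
      rw [hχ1 _ (by rw [norm_real, Real.norm_eq_abs]; linarith), one_mul]
    · simp [hGx, image_eq_zero_of_notMem_tsupport hx]
  · intro k
    obtain ⟨C1, hC1, h1⟩ := avg_decay k Set.univ (smooth_deriv hF) hFsupp.deriv hψ
      (fun n x _ => by rw [hψm, mul_zero])
    obtain ⟨C2, hC2, h2⟩ := avg_decay k (tsupport F)ᶜ hF hFsupp hφ (fun n x hx => by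
      have : iteratedDeriv n F x = 0 := by
        have he : F =ᶠ[𝓝 x] fun _ => (0 : ℂ) := notMem_tsupport_iff_eventuallyEq.1 hx
        rw [he.iteratedDeriv_eq]
        simp
      rw [this, zero_mul])
    obtain ⟨C4, hC4⟩ : ∃ C4 : ℝ, ∀ z, ‖G z‖ ≤ C4 := by
      obtain ⟨C, hC⟩ := exists_bd hF hFsupp
      refine ⟨∫ t, C * ‖φ t‖, fun z => ?_⟩
      refine norm_integral_le_of_norm_le (hφ.int.norm.const_mul C)
        (Eventually.of_forall fun t => ?_)
      rw [norm_mul]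
      gcongr
      exact hC _
    have hC40 : 0 ≤ C4 := (norm_nonneg _).trans (hC4 0)
    refine ⟨C1 + (C2 + C4) * M, fun z => ?_⟩
    have hA : ‖χ z * dbar G z‖ ≤ C1 * |z.im| ^ k := by
      rw [hGdb, norm_mul, norm_mul]
      have := h1 z (Set.mem_univ _)
      have hn : ‖(1 / 2 : ℂ)‖ ≤ 1 := by norm_num
      calc _ ≤ 1 * (1 * (C1 * |z.im| ^ k)) := by
            gcongr
            exact hχle z
        _ = _ := by ring
    have hB : ‖G z * dbar χ z‖ ≤ (C2 + C4) * M * |z.im| ^ k := by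
      have hy : 0 ≤ |z.im| ^ k := by positivity
      by_cases hx : z.re ∈ tsupport F
      · by_cases hy1 : |z.im| < 1
        · have hz : ‖z‖ < R + 1 := by
            have := norm_le_abs_re_add_abs_im z
            have := hR _ hx
            linarith
          have he : χ =ᶠ[𝓝 z] fun _ => (1 : ℂ) := by
            filter_upwards [(isOpen_lt continuous_norm continuous_const).mem_nhds hz] with w hw
            exact hχ1 w (le_of_lt hw)
          have : dbar χ z = 0 := by
            rw [dbar, he.fderiv_eq]; simp
          rw [this, mul_zero, norm_zero]
          positivity
        · have : 1 ≤ |z.im| ^ k := one_le_pow₀ (not_lt.1 hy1)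
          rw [norm_mul]
          calc _ ≤ C4 * M := by gcongr; exacts [hC4 z, hM z]
            _ ≤ (C2 + C4) * M := by gcongr; linarith
            _ ≤ _ := le_mul_of_one_le_right (by positivity) this
      · rw [norm_mul]
        calc _ ≤ (C2 * |z.im| ^ k) * M := by gcongr; exacts [h2 z hx, hM z]
            _ = C2 * M * |z.im| ^ k := by ring
            _ ≤ _ := by gcongr; linarith
    rw [hprod]
    refine (norm_add_le _ _).trans ((add_le_add hA hB).trans_eq ?_)
    ring
end

section
/- Let η : ℝ → ℝ be C^∞ with η(x) = 0 for x ≤ -1 and η(x) = 1 for x ≥ 1 (so that η' has compact support). Then there exists a smooth function η̃ : ℂ → ℂ (smooth as a function of the two real variables u, v where z = u + iv) with η̃(x) = η(x) for all real x, such that for every k ∈ ℕ there is a constant C_k with |(∂̄η̃)(z)| ≤ C_k ⟨z⟩^{-1-k} |Im z|^k for all z ∈ ℂ, where ⟨z⟩ = (1+|z|²)^{1/2}. -/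
open MeasureTheory Complex

namespace AAExt

/-- The averaged extension `z ↦ ∫ f(u + v t) φ(t) dt`. -/
noncomputable def ext (f : ℝ → ℝ) (φ : ℝ → ℂ) (z : ℂ) : ℂ :=
  ∫ t : ℝ, (f (z.re + z.im * t) : ℂ) * φ t

/-- All moments of `φ` are integrable. -/
def Mom (φ : ℝ → ℂ) : Prop := ∀ k : ℕ, Integrable (fun t : ℝ => (t : ℂ) ^ k * φ t)

/-- Smooth with all derivatives bounded. -/
def Nice (f : ℝ → ℝ) : Prop :=
  ContDiff ℝ (⊤ : ℕ∞) f ∧ ∀ m : ℕ, ∃ C : ℝ, ∀ x, |iteratedDeriv m f x| ≤ C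

lemma Mom.int {φ : ℝ → ℂ} (h : Mom φ) : Integrable φ := by simpa using h 0

lemma Mom.mul {φ : ℝ → ℂ} (h : Mom φ) : Mom (fun t : ℝ => (t : ℂ) * φ t) := by
  intro k
  have := h (k + 1)
  simpa [pow_succ, mul_assoc] using this

lemma Nice.deriv {f : ℝ → ℝ} (h : Nice f) : Nice (deriv f) := by
  refine ⟨?_, fun m => ?_⟩
  · exact (contDiff_infty_iff_deriv.1 h.1).2
  · have := h.2 (m + 1)
    rwa [iteratedDeriv_succ'] at this

lemma Nice.bdd {f : ℝ → ℝ} (h : Nice f) : ∃ C : ℝ, ∀ x, |f x| ≤ C := by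
  simpa using h.2 0

lemma integrable_ext {f : ℝ → ℝ} {φ : ℝ → ℂ} (hf : Nice f) (hφ : Integrable φ) (z : ℂ) :
    Integrable (fun t : ℝ => (f (z.re + z.im * t) : ℂ) * φ t) := by
  obtain ⟨C, hC⟩ := hf.bdd
  refine hφ.bdd_mul (c := C) ?_ ?_
  · have := hf.1.continuous
    exact Continuous.aestronglyMeasurable (by fun_prop)
  · exact Filter.Eventually.of_forall fun t => by simpa using hC _

lemma hasFDerivAt_ext {f : ℝ → ℝ} {φ : ℝ → ℂ} (hf : Nice f) (hφ : Mom φ) (z : ℂ) :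
    HasFDerivAt (ext f φ)
      (reCLM.smulRight (ext (deriv f) φ z) +
        imCLM.smulRight (ext (deriv f) (fun t : ℝ => (t : ℂ) * φ t) z)) z := by
  obtain ⟨C, hC⟩ := hf.deriv.bdd
  have hi1 := integrable_ext hf.deriv hφ.int z
  have hi2 := integrable_ext hf.deriv hφ.mul.int z
  let F' : ℂ → ℝ → ℂ →L[ℝ] ℂ := fun w t =>
    reCLM.smulRight (((deriv f) (w.re + w.im * t) : ℂ) * φ t) +
        imCLM.smulRight (((deriv f) (w.re + w.im * t) : ℂ) * ((t : ℂ) * φ t))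
  let L1 : ℂ →L[ℝ] (ℂ →L[ℝ] ℂ) := ContinuousLinearMap.smulRightL ℝ ℂ ℂ reCLM
  let L2 : ℂ →L[ℝ] (ℂ →L[ℝ] ℂ) := ContinuousLinearMap.smulRightL ℝ ℂ ℂ imCLM
  have hF' : ∀ w t, F' w t = L1 (((deriv f) (w.re + w.im * t) : ℂ) * φ t) +
      L2 (((deriv f) (w.re + w.im * t) : ℂ) * ((t : ℂ) * φ t)) := fun w t => rfl
  have hint : (∫ t, F' z t) = reCLM.smulRight (ext (deriv f) φ z) +
        imCLM.smulRight (ext (deriv f) (fun t : ℝ => (t : ℂ) * φ t) z) := by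
    simp_rw [hF']
    rw [integral_add (L1.integrable_comp hi1) (L2.integrable_comp hi2),
      L1.integral_comp_comm hi1, L2.integral_comp_comm hi2]
    rfl
  rw [← hint]
  refine hasFDerivAt_integral_of_dominated_of_fderiv_le (s := Set.univ)
    (F' := F') (bound := fun t => ‖L1‖ * (C * ‖φ t‖) + ‖L2‖ * (C * ‖(t : ℂ) * φ t‖))
    Filter.univ_mem ?_ ?_ ?_ ?_ ?_ ?_
  · exact Filter.Eventually.of_forall fun w => (integrable_ext hf hφ.int w).1
  · exact integrable_ext hf hφ.int z
  · exact ((L1.integrable_comp hi1).add (L2.integrable_comp hi2)).1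
  · refine Filter.Eventually.of_forall fun t w _ => ?_
    rw [hF']
    refine (norm_add_le _ _).trans (add_le_add ?_ ?_)
    · refine (L1.le_opNorm _).trans ?_
      rw [norm_mul]
      gcongr
      simpa using hC _
    · refine (L2.le_opNorm _).trans ?_
      rw [norm_mul]
      gcongr
      simpa using hC _
  · exact ((hφ.int.norm.const_mul C).const_mul _).add ((hφ.mul.int.norm.const_mul C).const_mul _)
  · refine Filter.Eventually.of_forall fun t w _ => ?_
    have hd : HasDerivAt f (deriv f (w.re + w.im * t)) (w.re + w.im * t) :=
      (hf.1.differentiable (by simp)).differentiableAt.hasDerivAt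
    have hl : HasFDerivAt (fun w : ℂ => w.re + w.im * t) (reCLM + t • imCLM) w := by
      have h1 := (reCLM.hasFDerivAt (x := w)).fun_add ((imCLM.hasFDerivAt (x := w)).mul_const t)
      exact h1
    have h2 := (hd.ofReal_comp.mul_const (φ t)).hasFDerivAt.comp w hl
    refine h2.congr_fderiv ?_
    ext <;> simp [F'] <;> ring

lemma contDiff_ext_nat (n : ℕ) : ∀ {f : ℝ → ℝ} {φ : ℝ → ℂ}, Nice f → Mom φ →
    ContDiff ℝ n (ext f φ) := by
  induction n with
  | zero =>
    intro f φ hf hφ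
    refine contDiff_zero.2 ?_
    exact continuous_iff_continuousAt.2 fun z => (hasFDerivAt_ext hf hφ z).continuousAt
  | succ n ih =>
    intro f φ hf hφ
    push_cast
    refine contDiff_succ_iff_hasFDerivAt.2 ⟨_, ?_, hasFDerivAt_ext hf hφ⟩
    exact (contDiff_const.smulRight (ih hf.deriv hφ)).add
      (contDiff_const.smulRight (ih hf.deriv hφ.mul))

lemma contDiff_ext {f : ℝ → ℝ} {φ : ℝ → ℂ} (hf : Nice f) (hφ : Mom φ) :
    ContDiff ℝ (⊤ : ℕ∞) (ext f φ) :=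
  contDiff_infty.2 fun n => contDiff_ext_nat n hf hφ

/-- Taylor-type estimate near the real axis. -/
lemma ext_le (k : ℕ) : ∀ {f : ℝ → ℝ} {φ : ℝ → ℂ}, Nice f → Mom φ →
    (∀ j : ℕ, ∫ t : ℝ, (t : ℂ) ^ j * φ t = 0) →
    ∃ C : ℝ, 0 ≤ C ∧ ∀ z, ‖ext f φ z‖ ≤ C * |z.im| ^ k := by
  induction k with
  | zero =>
    intro f φ hf hφ _
    obtain ⟨C, hC⟩ := hf.bdd
    have hC0 : 0 ≤ C := (abs_nonneg _).trans (hC 0)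
    refine ⟨∫ t, C * ‖φ t‖, integral_nonneg fun t => by positivity, fun z => ?_⟩
    simp only [pow_zero, mul_one]
    refine norm_integral_le_of_norm_le (hφ.int.norm.const_mul C) ?_
    refine Filter.Eventually.of_forall fun t => ?_
    rw [norm_mul]
    gcongr
    simpa using hC _
  | succ k ih =>
    intro f φ hf hφ h0
    obtain ⟨C1, hC1, h1⟩ := ih hf.deriv hφ h0
    obtain ⟨C2, hC2, h2⟩ := ih hf.deriv hφ.mul (fun j => by
      have := h0 (j + 1)
      simpa [pow_succ, mul_assoc] using this)
    refine ⟨C1 + C2, by positivity, fun z => ?_⟩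
    have hconv : Convex ℝ {w : ℂ | |w.im| ≤ |z.im|} := by
      have : {w : ℂ | |w.im| ≤ |z.im|} = imCLM ⁻¹' (Set.Icc (-|z.im|) |z.im|) := by
        ext w; simp [abs_le]
      rw [this]
      exact (convex_Icc _ _).linear_preimage imCLM.toLinearMap
    have key := Convex.norm_image_sub_le_of_norm_hasFDerivWithin_le (f := ext f φ)
      (C := (C1 + C2) * |z.im| ^ k) (x := (z.re : ℂ)) (y := z)
      (fun w _ => (hasFDerivAt_ext hf hφ w).hasFDerivWithinAt) (fun w hw => ?_) hconv
      (by simp) (by simp)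
    · have e0 : ext f φ (z.re : ℂ) = 0 := by
        have := h0 0
        simp only [pow_zero, one_mul] at this
        simp [ext, integral_const_mul, this]
      have e1 : z - (z.re : ℂ) = z.im * I := by
        apply Complex.ext <;> simp
      rw [e0, sub_zero, e1] at key
      simpa [pow_succ, mul_assoc] using key
    · have hw' : |w.im| ≤ |z.im| := hw
      have b : |w.im| ^ k ≤ |z.im| ^ k := by gcongr
      rw [add_mul]
      refine (norm_add_le _ _).trans (add_le_add ?_ ?_)
      · rw [ContinuousLinearMap.norm_smulRight_apply, reCLM_norm, one_mul]
        exact (h1 w).trans (by gcongr)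
      · rw [ContinuousLinearMap.norm_smulRight_apply, imCLM_norm, one_mul]
        exact (h2 w).trans (by gcongr)

/-- Decay away from the origin. -/
lemma ext_far (k : ℕ) {f : ℝ → ℝ} {φ : ℝ → ℂ} (hf : Continuous f)
    (hs : ∀ x, 1 < |x| → f x = 0) 
    {D : ℝ} (hD : ∀ t : ℝ, (1 + |t|) ^ (k + 1) * ‖φ t‖ ≤ D) :
    ∃ C : ℝ, 0 ≤ C ∧ ∀ z : ℂ, 2 ≤ ‖z‖ → ‖ext f φ z‖ * ‖z‖ ^ (k + 1) ≤ C * |z.im| ^ k := by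
  have hD0 : 0 ≤ D := le_trans (by positivity) (hD 0)
  have hcs : HasCompactSupport f := by
    refine HasCompactSupport.intro (isCompact_Icc (a := (-1 : ℝ)) (b := 1)) fun x hx => hs x ?_
    by_contra h
    exact hx (abs_le.1 (not_lt.1 h))
  have hfi : Integrable f := hf.integrable_of_hasCompactSupport hcs
  have hM : 0 ≤ ∫ x, |f x| := integral_nonneg fun x => abs_nonneg _
  refine ⟨D * 2 ^ (k + 1) * ∫ x, |f x|, by positivity, fun z hz => ?_⟩
  have hzpos : 0 < ‖z‖ := by linarith
  by_cases hv : z.im = 0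
  · have h1 : 1 < |z.re| := by
      have := Complex.norm_le_abs_re_add_abs_im z
      rw [hv, abs_zero, add_zero] at this
      linarith
    have : ext f φ z = 0 := by simp [ext, hv, hs _ h1]
    rw [this]
    simp only [norm_zero, zero_mul]
    positivity
  · have hv' : 0 < |z.im| := abs_pos.2 hv
    have hI : Integrable (fun t : ℝ => |f (z.re + z.im * t)|) :=
      ((hfi.abs.comp_add_left z.re).comp_mul_left' hv)
    have hIe : ∫ t : ℝ, |f (z.re + z.im * t)| = |z.im|⁻¹ * ∫ x, |f x| := by
      rw [Measure.integral_comp_mul_left (fun s => |f (z.re + s)|) z.im,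
        integral_add_left_eq_self (fun s => |f s|) z.re, abs_inv, smul_eq_mul]
    have hb : ‖ext f φ z‖ ≤ ∫ t : ℝ, (D * (2 * |z.im| / ‖z‖) ^ (k + 1)) *
        |f (z.re + z.im * t)| := by
      refine norm_integral_le_of_norm_le (hI.const_mul _) ?_
      refine Filter.Eventually.of_forall fun t => ?_
      rw [norm_mul, mul_comm, norm_real, Real.norm_eq_abs]
      by_cases h : 1 < |z.re + z.im * t|
      · simp [hs _ h]
      · gcongr
        have h' := not_lt.1 h
        have h2 : ‖z‖ / 2 ≤ |z.im| * (1 + |t|) := by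
          have a1 := Complex.norm_le_abs_re_add_abs_im z
          have a2 : |z.re| ≤ |z.re + z.im * t| + |z.im| * |t| := by
            rw [← abs_mul]
            simpa using abs_sub (z.re + z.im * t) (z.im * t)
          nlinarith
        have h3 : 1 ≤ (2 * |z.im| / ‖z‖) * (1 + |t|) := by
          rw [div_mul_eq_mul_div, le_div_iff₀ hzpos]
          linarith
        calc ‖φ t‖ = 1 ^ (k + 1) * ‖φ t‖ := by simp
          _ ≤ ((2 * |z.im| / ‖z‖) * (1 + |t|)) ^ (k + 1) * ‖φ t‖ := by gcongr
          _ = ((1 + |t|) ^ (k + 1) * ‖φ t‖) * (2 * |z.im| / ‖z‖) ^ (k + 1) := by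
            rw [mul_pow]; ring
          _ ≤ D * (2 * |z.im| / ‖z‖) ^ (k + 1) := by gcongr; exact hD t
    rw [integral_const_mul, hIe] at hb
    calc ‖ext f φ z‖ * ‖z‖ ^ (k + 1) ≤
        (D * (2 * |z.im| / ‖z‖) ^ (k + 1) * (|z.im|⁻¹ * ∫ (x : ℝ), |f x|)) * ‖z‖ ^ (k + 1) := by
          gcongr
      _ = _ := by
        rw [div_pow, mul_pow, pow_succ |z.im|]
        field_simp

lemma iteratedDeriv_cexp_real (n : ℕ) (c : ℂ) :
    iteratedDeriv n (fun s : ℝ => cexp (c * s)) = fun s : ℝ => c ^ n * cexp (c * s) := by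
  induction n with
  | zero => simp
  | succ n ih =>
    rw [iteratedDeriv_succ, ih]
    ext s
    have h : HasDerivAt (fun s : ℝ => cexp (c * s)) (cexp (c * s) * (c * 1)) s :=
      ((Complex.ofRealCLM.hasDerivAt (x := s)).const_mul c).cexp
    rw [(h.const_mul (c ^ n)).deriv]
    ring

open FourierTransform in
lemma exists_phi : ∃ φ : SchwartzMap ℝ ℂ, ∀ j : ℕ, ∫ t : ℝ, (t : ℂ) ^ j * φ t = I ^ j := by
  let χ : ContDiffBump (0 : ℝ) := ⟨1, 2, by norm_num, by norm_num⟩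
  let c : ℂ := 2 * Real.pi
  let h : ℝ → ℂ := fun s => (χ s : ℂ) * cexp (c * s)
  have hc : HasCompactSupport h := by
    have : HasCompactSupport (fun s : ℝ => (χ s : ℂ)) :=
      χ.hasCompactSupport.comp_left (g := fun x : ℝ => (x : ℂ)) (by simp)
    exact this.mul_right
  have hd : ContDiff ℝ (⊤ : ℕ∞) h := by
    refine ContDiff.mul (ofRealCLM.contDiff.comp χ.contDiff) ?_
    exact (contDiff_const.mul ofRealCLM.contDiff).cexp
  let H : SchwartzMap ℝ ℂ := hc.toSchwartzMap hd
  refine ⟨𝓕⁻ H, fun j => ?_⟩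
  have e1 : 𝓕 ((𝓕⁻ H : SchwartzMap ℝ ℂ) : ℝ → ℂ) = h := by
    rw [← SchwartzMap.fourier_coe, fourier_fourierInv_eq]
    rfl
  have e2 : iteratedDeriv j h 0 = c ^ j := by
    have : h =ᶠ[nhds 0] fun s : ℝ => cexp (c * s) := by
      filter_upwards [χ.eventuallyEq_one] with s hs
      simp [h, hs]
    rw [this.iteratedDeriv_eq, iteratedDeriv_cexp_real]
    simp
  have hint : ∀ n : ℕ, Integrable (fun x : ℝ => x ^ n • (𝓕⁻ H : SchwartzMap ℝ ℂ) x) := by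
    intro n
    refine ((𝓕⁻ H : SchwartzMap ℝ ℂ).integrable_pow_mul volume n).mono' ?_ ?_
    · have := (𝓕⁻ H : SchwartzMap ℝ ℂ).continuous
      exact Continuous.aestronglyMeasurable (by fun_prop)
    · exact Filter.Eventually.of_forall fun t => by simp
  have e3 := Real.iteratedDeriv_fourier (N := ⊤) (n := j) (fun n _ => hint n) le_top
  rw [e1] at e3
  have e4 := congrFun e3 0
  rw [e2, Real.fourier_eq'] at e4
  have e5 : ∀ t : ℝ, cexp (((-2 * Real.pi * inner ℝ t (0 : ℝ) : ℝ) : ℂ) * I) •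
      ((-2 * (Real.pi : ℂ) * I * t) ^ j • (𝓕⁻ H : SchwartzMap ℝ ℂ) t) =
      (c ^ j * (-I) ^ j) * ((t : ℂ) ^ j * (𝓕⁻ H : SchwartzMap ℝ ℂ) t) := by
    intro t
    have : -2 * (Real.pi : ℂ) * I * t = c * (-I) * t := by simp only [c]; ring
    rw [this, mul_pow, mul_pow]
    simp [mul_assoc]
  simp_rw [e5] at e4
  rw [integral_const_mul, mul_assoc] at e4
  have hc0 : c ^ j ≠ 0 := pow_ne_zero _ (by simp [c, Real.pi_ne_zero])
  have e6 := mul_left_cancel₀ hc0 ((mul_one _).trans e4)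
  have e7 : I ^ j * (-I) ^ j = 1 := by rw [← mul_pow]; simp
  calc _ = (I ^ j * (-I) ^ j) * ∫ t : ℝ, (t : ℂ) ^ j * (𝓕⁻ H : SchwartzMap ℝ ℂ) t := by
        rw [e7, one_mul]
    _ = I ^ j := by rw [mul_assoc, ← e6, mul_one]

lemma iteratedDeriv_one_side {η : ℝ → ℝ} {a x : ℝ} (ha : |a| ≤ 1)
    (h : η =ᶠ[nhds x] fun _ => a) (m : ℕ) : |iteratedDeriv m η x| ≤ 1 := by
  rw [h.iteratedDeriv_eq, iteratedDeriv_const]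
  split_ifs
  · exact ha
  · simp

lemma eventually_right {η : ℝ → ℝ} (h1 : ∀ x : ℝ, 1 ≤ x → η x = 1) {x : ℝ} (hx : 1 < x) :
    η =ᶠ[nhds x] fun _ => 1 := by
  filter_upwards [lt_mem_nhds hx] with y hy using h1 y hy.le

lemma eventually_left {η : ℝ → ℝ} (h0 : ∀ x : ℝ, x ≤ -1 → η x = 0) {x : ℝ} (hx : x < -1) :
    η =ᶠ[nhds x] fun _ => 0 := by
  filter_upwards [gt_mem_nhds hx] with y hy using h0 y hy.le

lemma nice_eta {η : ℝ → ℝ} (hη : ContDiff ℝ (⊤ : ℕ∞) η)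
    (h0 : ∀ x : ℝ, x ≤ -1 → η x = 0) (h1 : ∀ x : ℝ, 1 ≤ x → η x = 1) : Nice η := by
  refine ⟨hη, fun m => ?_⟩
  have hc : Continuous (iteratedDeriv m η) :=
    hη.continuous_iteratedDeriv m (by exact_mod_cast le_top)
  obtain ⟨C, hC⟩ := (isCompact_Icc (a := (-1 : ℝ)) (b := 1)).exists_bound_of_continuousOn
    hc.continuousOn
  refine ⟨max C 1, fun x => ?_⟩
  rcases lt_or_ge x (-1) with hx | hx
  · exact (iteratedDeriv_one_side (by simp) (eventually_left h0 hx) m).trans (le_max_right _ _)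
  rcases lt_or_ge 1 x with hx' | hx'
  · exact (iteratedDeriv_one_side (by simp) (eventually_right h1 hx') m).trans (le_max_right _ _)
  · exact (hC x ⟨hx, hx'⟩).trans (le_max_left _ _)

lemma deriv_eta {η : ℝ → ℝ} 
    (h0 : ∀ x : ℝ, x ≤ -1 → η x = 0) (h1 : ∀ x : ℝ, 1 ≤ x → η x = 1) (x : ℝ) (hx : 1 < |x|) :
    deriv η x = 0 := by
  rcases lt_abs.1 hx with h | h
  · rw [(eventually_right h1 h).deriv_eq]; simp
  · rw [(eventually_left h0 (by linarith)).deriv_eq]; simp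

lemma mom_schwartz (φ : SchwartzMap ℝ ℂ) : Mom φ := by
  intro n
  refine (φ.integrable_pow_mul volume n).mono' ?_ ?_
  · have := φ.continuous
    exact Continuous.aestronglyMeasurable (by fun_prop)
  · exact Filter.Eventually.of_forall fun t => by simp

lemma decay_schwartz (φ : SchwartzMap ℝ ℂ) (k : ℕ) :
    ∃ D : ℝ, ∀ t : ℝ, (1 + |t|) ^ k * ‖φ t‖ ≤ D := by
  refine ⟨2 ^ k * ((Finset.Iic (k, 0)).sup fun m : ℕ × ℕ => SchwartzMap.seminorm ℝ m.1 m.2) φ,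
    fun t => ?_⟩
  have := SchwartzMap.one_add_le_sup_seminorm_apply (𝕜 := ℝ) (m := (k, 0)) (k := k) (n := 0)
    le_rfl le_rfl φ t
  rw [norm_iteratedFDeriv_zero, Real.norm_eq_abs] at this
  exact this

lemma weight_eq (r : ℝ) (k : ℕ) :
    (1 + r ^ 2) ^ ((-1 - (k : ℝ)) / 2) = (Real.sqrt (1 + r ^ 2) ^ (k + 1))⁻¹ := by
  have h : 0 ≤ 1 + r ^ 2 := by positivity
  rw [Real.sqrt_eq_rpow, ← Real.rpow_mul_natCast h, ← Real.rpow_neg h]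
  congr 1
  push_cast
  ring

end AAExt

open AAExt in
/-- A smooth `η : ℝ → ℝ` with `η = 0` on `(-∞,-1]` and `η = 1` on `[1,∞)`
admits a smooth extension `η̃ : ℂ → ℂ` with `η̃|ℝ = η` and
`|∂̄η̃(z)| ≤ C_k ⟨z⟩^{-1-k} |Im z|^k` for every `k`, where `⟨z⟩ = (1+|z|²)^{1/2}`. -/
theorem exists_almost_analytic_extension_eta (η : ℝ → ℝ)
    (hη : ContDiff ℝ (⊤ : ℕ∞) η)
    (h0 : ∀ x : ℝ, x ≤ -1 → η x = 0)
    (h1 : ∀ x : ℝ, 1 ≤ x → η x = 1) :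
    ∃ ηtil : ℂ → ℂ, ContDiff ℝ (⊤ : ℕ∞) ηtil ∧
      (∀ x : ℝ, ηtil (x : ℂ) = (η x : ℂ)) ∧
      ∀ k : ℕ, ∃ C : ℝ, ∀ z : ℂ,
        ‖dbar ηtil z‖ ≤ C * (1 + ‖z‖ ^ 2) ^ ((-1 - (k : ℝ)) / 2) * |z.im| ^ k := by
  obtain ⟨φ, hφ⟩ := exists_phi
  have hN := nice_eta hη h0 h1
  have hM := mom_schwartz φ
  refine ⟨AAExt.ext η φ, contDiff_ext hN hM, fun x => ?_, fun k => ?_⟩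
  · have := hφ 0
    simp only [pow_zero, one_mul] at this
    simp [AAExt.ext, integral_const_mul, this]
  let ψ : ℝ → ℂ := fun t => φ t + I * ((t : ℂ) * φ t)
  have hψM : Mom ψ := by
    intro n
    have := (hM n).add ((hM.mul n).const_mul I)
    refine this.congr (Filter.Eventually.of_forall fun t => ?_)
    simp only [ψ, Pi.add_apply]
    ring
  have hψ0 : ∀ j : ℕ, ∫ t : ℝ, (t : ℂ) ^ j * ψ t = 0 := by
    intro j
    have e : ∀ t : ℝ, (t : ℂ) ^ j * ψ t = (t : ℂ) ^ j * φ t + I * ((t : ℂ) ^ (j + 1) * φ t) := by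
      intro t
      simp only [ψ]
      ring
    simp_rw [e]
    rw [integral_add (hM j) ((hM (j + 1)).const_mul I), integral_const_mul, hφ, hφ, pow_succ]
    linear_combination (I ^ j) * I_mul_I
  have hdbar : ∀ z, dbar (AAExt.ext η φ) z = (1 / 2) * AAExt.ext (deriv η) ψ z := by
    intro z
    have e : AAExt.ext (deriv η) ψ z = AAExt.ext (deriv η) φ z +
        I * AAExt.ext (deriv η) (fun t : ℝ => (t : ℂ) * φ t) z := by
      unfold AAExt.ext
      rw [← integral_const_mul, ← integral_add (integrable_ext hN.deriv hM.int z)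
        ((integrable_ext hN.deriv hM.mul.int z).const_mul I)]
      congr 1
      ext t
      simp only [ψ]
      ring
    rw [dbar, (hasFDerivAt_ext hN hM z).fderiv, e]
    simp
  obtain ⟨D, hD⟩ := decay_schwartz φ (k + 2)
  have hψD : ∀ t : ℝ, (1 + |t|) ^ (k + 1) * ‖ψ t‖ ≤ D := by
    intro t
    refine le_trans ?_ (hD t)
    have : ‖ψ t‖ ≤ (1 + |t|) * ‖φ t‖ := by
      refine (norm_add_le _ _).trans ?_
      simp [add_mul]
    calc _ ≤ (1 + |t|) ^ (k + 1) * ((1 + |t|) * ‖φ t‖) := by gcongr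
      _ = _ := by ring
  obtain ⟨C1, hC1, hb1⟩ := ext_le k hN.deriv hψM hψ0
  obtain ⟨C2, hC2, hb2⟩ := ext_far k hN.deriv.1.continuous (deriv_eta h0 h1) hψD
  refine ⟨C1 * 3 ^ (k + 1) + C2 * 2 ^ (k + 1), fun z => ?_⟩
  rw [weight_eq, hdbar, norm_mul]
  set s := Real.sqrt (1 + ‖z‖ ^ 2) with hs
  have hspos : 0 < s := Real.sqrt_pos.2 (by positivity)
  have hhalf : ‖(1 / 2 : ℂ)‖ ≤ 1 := by norm_num
  suffices h : ‖AAExt.ext (deriv η) ψ z‖ * s ^ (k + 1) ≤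
      (C1 * 3 ^ (k + 1) + C2 * 2 ^ (k + 1)) * |z.im| ^ k by
    calc _ ≤ 1 * ‖AAExt.ext (deriv η) ψ z‖ := by gcongr
      _ = (‖AAExt.ext (deriv η) ψ z‖ * s ^ (k + 1)) * (s ^ (k + 1))⁻¹ := by field_simp
      _ ≤ ((C1 * 3 ^ (k + 1) + C2 * 2 ^ (k + 1)) * |z.im| ^ k) * (s ^ (k + 1))⁻¹ := by gcongr
      _ = _ := by ring
  rw [add_mul]
  rcases le_total 2 ‖z‖ with hz | hz
  · have hsz : s ≤ 2 * ‖z‖ := Real.sqrt_le_iff.2 ⟨by positivity, by nlinarith⟩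
    calc _ ≤ ‖AAExt.ext (deriv η) ψ z‖ * (2 * ‖z‖) ^ (k + 1) := by gcongr
      _ = (‖AAExt.ext (deriv η) ψ z‖ * ‖z‖ ^ (k + 1)) * 2 ^ (k + 1) := by rw [mul_pow]; ring
      _ ≤ (C2 * |z.im| ^ k) * 2 ^ (k + 1) := mul_le_mul_of_nonneg_right (hb2 z hz) (by positivity)
      _ = C2 * 2 ^ (k + 1) * |z.im| ^ k := by ring
      _ ≤ _ := le_add_of_nonneg_left (by positivity)
  · have hsz : s ≤ 3 := Real.sqrt_le_iff.2 ⟨by positivity, by nlinarith [norm_nonneg z]⟩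
    calc _ ≤ (C1 * |z.im| ^ k) * 3 ^ (k + 1) := by gcongr; exact hb1 z
      _ = C1 * 3 ^ (k + 1) * |z.im| ^ k := by ring
      _ ≤ _ := le_add_of_nonneg_right (by positivity)
end

section
/- Helffer–Sjöstrand formula (bounded version): Let 𝓗 be a complex Hilbert space, B a bounded self-adjoint operator on 𝓗, F : ℝ → ℂ a compactly supported smooth function, and F̃ an almost analytic extension of F. Then F(B) = π^{-1} ∫_ℂ (∂̄F̃)(z) (B - z)^{-1} du dv, where the integral is a Bochner integral in the bounded operators over ℂ with planar Lebesgue measure (the integrand, defined for Im z ≠ 0, is integrable since ‖(B - z)^{-1}‖ ≤ |Im z|^{-1} and |(∂̄F̃)(z)| ≤ C_2 |Im z|² on a compact set). -/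
open MeasureTheory

open Complex in
/-- Cauchy–Pompeiu formula at the origin. -/
theorem pompeiu_zero (g : ℂ → ℂ) (hg : ContDiff ℝ 1 g) (hs : HasCompactSupport g) :
    ∫ z : ℂ, dbar g z * (-z)⁻¹ = Real.pi * g 0 := by
  obtain ⟨R, hR0, hR⟩ : ∃ R : ℝ, 0 < R ∧ ∀ z : ℂ, R < ‖z‖ → g z = 0 ∧ fderiv ℝ g z = 0 := by
    obtain ⟨R, hR⟩ := hs.isCompact.isBounded.subset_closedBall (0 : ℂ)
    refine ⟨max R 1, by positivity, fun z hz => ?_⟩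
    have hz' : z ∉ tsupport g := fun h => by
      have := hR h
      simp only [Metric.mem_closedBall, dist_zero_right] at this
      have := le_max_left R 1
      linarith
    exact ⟨image_eq_zero_of_notMem_tsupport hz',
      Function.notMem_support.1 fun h => hz' (support_fderiv_subset ℝ h)⟩
  have hcf : Continuous (fderiv ℝ g) := hg.continuous_fderiv (by norm_num)
  have hd : Differentiable ℝ g := hg.differentiable (by norm_num)
  set E : ℝ → ℂ := fun θ => Real.cos θ + Real.sin θ * I with hE
  have hEc : Continuous E := by simp only [hE]; fun_prop
  have hEn : ∀ θ, ‖E θ‖ = 1 := fun θ => by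
    simp only [hE, ofReal_cos, ofReal_sin]
    rw [Complex.norm_cos_add_sin_mul_I]
  have hEd : ∀ θ, HasDerivAt E (I * E θ) θ := fun θ => by
    have h1 := (Real.hasDerivAt_cos θ).ofReal_comp
    have h2 := ((Real.hasDerivAt_sin θ).ofReal_comp).mul_const I
    refine (h1.add h2).congr_deriv ?_
    simp only [hE]
    push_cast
    linear_combination (-Complex.sin θ) * I_mul_I
  set G1 : ℝ × ℝ → ℂ := fun p => fderiv ℝ g (p.1 * E p.2) (E p.2) with hG1
  set G2 : ℝ × ℝ → ℂ := fun p => fderiv ℝ g (p.1 * E p.2) (I * E p.2) with hG2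
  have hG1c : Continuous G1 := by
    refine (hcf.comp ?_).clm_apply ?_ <;> fun_prop
  have hG2c : Continuous G2 := by
    refine (hcf.comp ?_).clm_apply ?_ <;> fun_prop
  have hnorm : ∀ r θ : ℝ, ‖(r : ℂ) * E θ‖ = |r| := fun r θ => by simp [hEn]
  have hint : ∀ G : ℝ × ℝ → ℂ, Continuous G → (∀ p : ℝ × ℝ, R < p.1 → G p = 0) →
      IntegrableOn G (Set.Ioi (0 : ℝ) ×ˢ Set.Ioo (-Real.pi) Real.pi) := by
    intro G hG h0
    have hK : IntegrableOn G (Set.Icc (0 : ℝ) R ×ˢ Set.Icc (-Real.pi) Real.pi) :=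
      hG.continuousOn.integrableOn_compact (isCompact_Icc.prod isCompact_Icc)
    refine hK.of_forall_sdiff_eq_zero (measurableSet_Ioi.prod measurableSet_Ioo) ?_
    rintro ⟨r, θ⟩ ⟨⟨h1, h2⟩, h3⟩
    apply h0
    by_contra hr
    exact h3 ⟨⟨le_of_lt h1, not_lt.1 hr⟩, ⟨h2.1.le, h2.2.le⟩⟩
  have hz1 : ∀ p : ℝ × ℝ, R < p.1 → G1 p = 0 := fun p hp => by
    simp only [hG1]
    rw [(hR _ (by rw [hnorm]; exact lt_of_lt_of_le hp (le_abs_self _))).2]; simp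
  have hz2 : ∀ p : ℝ × ℝ, R < p.1 → G2 p = 0 := fun p hp => by
    simp only [hG2]
    rw [(hR _ (by rw [hnorm]; exact lt_of_lt_of_le hp (le_abs_self _))).2]; simp
  have hi1 := hint G1 hG1c hz1
  have hi2 := hint G2 hG2c hz2
  have hint1 : ∫ p in Set.Ioi (0 : ℝ) ×ˢ Set.Ioo (-Real.pi) Real.pi, G1 p
      = -(2 * Real.pi * g 0) := by
    rw [Measure.volume_eq_prod, ← setIntegral_prod_swap, setIntegral_prod]
    · have : ∀ θ : ℝ, ∫ r in Set.Ioi (0 : ℝ), G1 (r, θ) = - g 0 := by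
        intro θ
        have hl : ContDiff ℝ 1 (fun r : ℝ => g (r * E θ)) := by
          refine hg.comp ?_
          exact ofRealCLM.contDiff.mul contDiff_const
        have hcs : HasCompactSupport (fun r : ℝ => g (r * E θ)) := by
          refine HasCompactSupport.intro (isCompact_Icc (a := -R) (b := R)) fun r hr => ?_
          refine (hR _ ?_).1
          rw [hnorm]
          by_contra h
          exact hr (abs_le.1 (not_lt.1 h))
        have := HasCompactSupport.integral_Ioi_deriv_eq hl hcs 0
        simp only [ofReal_zero, zero_mul] at this
        rw [← this]
        refine integral_congr_ae (.of_forall fun r => ?_)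
        have h1 : HasDerivAt (fun r : ℝ => (r : ℂ) * E θ) (E θ) r := by
          simpa using (hasDerivAt_id r).ofReal_comp.mul_const (E θ)
        exact (((hd _).hasFDerivAt.comp_hasDerivAt r h1).deriv).symm
      simp only [Prod.swap_prod_mk, this]
      rw [setIntegral_const]
      rw [Measure.real, Real.volume_Ioo, ENNReal.toReal_ofReal (by linarith [Real.pi_pos]),
        real_smul]
      push_cast; ring
    · exact hi1.swap
  have hint2 : ∫ p in Set.Ioi (0 : ℝ) ×ˢ Set.Ioo (-Real.pi) Real.pi, G2 p = 0 := by
    rw [Measure.volume_eq_prod, setIntegral_prod _ hi2]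
    refine setIntegral_eq_zero_of_forall_eq_zero fun r hr => ?_
    have hr' : (r : ℂ) ≠ 0 := by exact_mod_cast (ne_of_gt hr)
    rw [← integral_Ioc_eq_integral_Ioo,
      ← intervalIntegral.integral_of_le (by linarith [Real.pi_pos])]
    have h1 : ∀ θ ∈ Set.uIcc (-Real.pi) Real.pi,
        HasDerivAt (fun θ : ℝ => (r : ℂ)⁻¹ * g (r * E θ)) (G2 (r, θ)) θ := by
      intro θ _
      have h2 := ((hd _).hasFDerivAt.comp_hasDerivAt θ ((hEd θ).const_mul (r : ℂ))).const_mul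
        (r : ℂ)⁻¹
      refine h2.congr_deriv ?_
      simp only [hG2]
      rw [← real_smul (x := r) (z := I * E θ), map_smul, real_smul, inv_mul_cancel_left₀ hr']
    rw [intervalIntegral.integral_eq_sub_of_hasDerivAt h1
      ((hG2c.comp (by fun_prop : Continuous fun θ : ℝ => (r, θ))).intervalIntegrable _ _)]
    simp [hE]
  rw [← Complex.integral_comp_polarCoord_symm]
  have : ∫ p in polarCoord.target, p.1 • (dbar g (Complex.polarCoord.symm p) *
      (-Complex.polarCoord.symm p)⁻¹) =
      ∫ p in Set.Ioi (0 : ℝ) ×ˢ Set.Ioo (-Real.pi) Real.pi, (-1/2) * (G1 p + I * G2 p) := by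
    refine setIntegral_congr_fun (measurableSet_Ioi.prod measurableSet_Ioo) ?_
    rintro ⟨r, θ⟩ ⟨hr, -⟩
    have hr' : (r : ℂ) ≠ 0 := by exact_mod_cast (ne_of_gt hr)
    have hE0 : E θ ≠ 0 := fun h => by simpa [h] using hEn θ
    have e1 : fderiv ℝ g (r * E θ) (E θ) = Real.cos θ * fderiv ℝ g (r * E θ) 1
        + Real.sin θ * fderiv ℝ g (r * E θ) I := by
      have : E θ = Real.cos θ • (1 : ℂ) + Real.sin θ • I := by simp [hE]
      conv_lhs => rw [show fderiv ℝ g (r * E θ) (E θ) = fderiv ℝ g (r * E θ)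
        (Real.cos θ • (1 : ℂ) + Real.sin θ • I) from congrArg _ this]
      rw [map_add, map_smul, map_smul]; simp
    have e2 : fderiv ℝ g (r * E θ) (I * E θ) = -Real.sin θ * fderiv ℝ g (r * E θ) 1
        + Real.cos θ * fderiv ℝ g (r * E θ) I := by
      have : I * E θ = (-Real.sin θ) • (1 : ℂ) + Real.cos θ • I := by
        simp [hE]; linear_combination (Complex.sin θ) * I_mul_I
      conv_lhs => rw [show fderiv ℝ g (r * E θ) (I * E θ) = fderiv ℝ g (r * E θ)
        ((-Real.sin θ) • (1 : ℂ) + Real.cos θ • I) from congrArg _ this]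
      rw [map_add, map_smul, map_smul]; simp
    have e3 : (E θ)⁻¹ = Real.cos θ - Real.sin θ * I := by
      refine inv_eq_of_mul_eq_one_right ?_
      simp only [hE]; push_cast
      linear_combination Complex.cos_sq_add_sin_sq θ - (Complex.sin θ)^2 * I_mul_I
    have e4 : Complex.polarCoord.symm (r, θ) = r * E θ := by simp [hE]
    simp only [e4, hG1, hG2, e1, e2, dbar, inv_neg, mul_inv, e3, real_smul]
    field_simp
    push_cast
    ring_nf
    simp only [I_sq]
    ring
  rw [this, integral_const_mul, integral_add hi1 (hi2.const_mul I), integral_const_mul,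
    hint1, hint2]
  ring

theorem pompeiu (f : ℂ → ℂ) (hf : ContDiff ℝ 1 f) (hs : HasCompactSupport f) (x : ℂ) :
    ∫ z : ℂ, dbar f z * (x - z)⁻¹ = Real.pi * f x := by
  have h := pompeiu_zero (fun z => f (z + x)) (hf.comp (contDiff_id.add contDiff_const))
    (hs.comp_homeomorph (Homeomorph.addRight x))
  simp only [zero_add] at h
  rw [← h, ← integral_add_right_eq_self _ x]
  refine integral_congr_ae (.of_forall fun z => ?_)
  simp [dbar, fderiv_comp_add_right]

/-- **Helffer–Sjöstrand formula, bounded version.** For a bounded self-adjoint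
operator `B` on a complex Hilbert space, a compactly supported smooth `F : ℝ → ℂ` and an
almost analytic extension `F̃` of `F`,
`F(B) = π⁻¹ ∫_ℂ (∂̄F̃)(z) (B - z)⁻¹ du dv`, the integral being a Bochner integral over `ℂ`
with planar Lebesgue measure (here `(B - z)⁻¹ = Ring.inverse (B - z•1)`, which is the resolvent
whenever `Im z ≠ 0`). -/
theorem helffer_sjostrand_bounded
    {𝓗 : Type*} [NormedAddCommGroup 𝓗] [InnerProductSpace ℂ 𝓗] [CompleteSpace 𝓗]
    (B : 𝓗 →L[ℂ] 𝓗) (hB : IsSelfAdjoint B)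
    (F : ℝ → ℂ) (hF : ContDiff ℝ (⊤ : ℕ∞) F) (hFsupp : HasCompactSupport F)
    (Ftil : ℂ → ℂ) (hFt : ContDiff ℝ (⊤ : ℕ∞) Ftil) (hFtsupp : HasCompactSupport Ftil)
    (hext : ∀ x : ℝ, Ftil (x : ℂ) = F x)
    (haa : ∀ k : ℕ, ∃ C : ℝ, ∀ z : ℂ, ‖dbar Ftil z‖ ≤ C * |z.im| ^ k) :
    cfc (fun z : ℂ => F z.re) B =
      (Real.pi)⁻¹ • ∫ z : ℂ, (dbar Ftil z) • Ring.inverse (B - z • 1) := by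
  have hC1 : ContDiff ℝ 1 Ftil := hFt.of_le (by exact_mod_cast le_top)
  have hcf : Continuous (fderiv ℝ Ftil) := hC1.continuous_fderiv (by norm_num)
  have hdc : Continuous (dbar Ftil) := by
    unfold dbar; fun_prop
  have hdsupp : HasCompactSupport (dbar Ftil) := by
    refine (hFtsupp.fderiv ℝ).mono ?_
    intro z hz h
    apply hz
    simp [dbar, h]
  have hspec : ∀ w ∈ spectrum ℂ B, w.im = 0 := fun w hw => hB.im_eq_zero_of_mem_spectrum hw
  obtain ⟨C, hC⟩ := haa 2
  have hC0 : 0 ≤ C := by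
    have := (norm_nonneg _).trans (hC Complex.I)
    simpa using this
  have hd0 : ∀ z : ℂ, z.im = 0 → dbar Ftil z = 0 := fun z hz => by
    have := hC z
    simpa [hz] using this
  have hbd : ∀ z w : ℂ, w.im = 0 → ‖dbar Ftil z * (w - z)⁻¹‖ ≤ C * |z.im| := by
    intro z w hw
    by_cases hz : z.im = 0
    · simp [hd0 z hz, hz]
    have h1 : |z.im| ≤ ‖w - z‖ := by
      have := Complex.abs_im_le_norm (w - z)
      simpa [hw] using this
    have hp : 0 < |z.im| := abs_pos.2 hz
    rw [norm_mul, norm_inv, ← div_eq_mul_inv, div_le_iff₀ (hp.trans_le h1)]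
    calc _ ≤ C * |z.im| ^ 2 := hC z
      _ = C * |z.im| * |z.im| := by ring
      _ ≤ _ := by gcongr
  have hcontW : ∀ z : ℂ, z.im ≠ 0 → ∀ w ∈ spectrum ℂ B, w - z ≠ 0 := by
    intro z hz w hw h
    apply hz
    rw [← sub_eq_zero.1 h]
    exact hspec w hw
  have key : cfc (fun w : ℂ => ∫ z : ℂ, dbar Ftil z * (w - z)⁻¹) B
      = ∫ z : ℂ, cfc (fun w : ℂ => dbar Ftil z * (w - z)⁻¹) B := by
    refine cfc_integral (fun z w : ℂ => dbar Ftil z * (w - z)⁻¹)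
      (fun z => (tsupport (dbar Ftil)).indicator (fun z => C * |z.im|) z) B ?_ ?_ ?_ ?_
    · rintro ⟨z, w⟩ ⟨-, hw⟩
      by_cases hz : z.im = 0
      · have hv : Function.uncurry (fun z w : ℂ => dbar Ftil z * (w - z)⁻¹) (z, w) = 0 := by
          simp [hd0 z hz]
        rw [ContinuousWithinAt, hv]
        have ht : Filter.Tendsto (fun p : ℂ × ℂ => C * |p.1.im|)
            (nhdsWithin (z, w) (Set.univ ×ˢ spectrum ℂ B)) (nhds 0) := by
          have : Continuous (fun p : ℂ × ℂ => C * |p.1.im|) := by fun_prop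
          have h2 := this.tendsto (z, w)
          simp only [hz, abs_zero, mul_zero] at h2
          exact h2.mono_left nhdsWithin_le_nhds
        refine squeeze_zero_norm' ?_ ht
        filter_upwards [self_mem_nhdsWithin] with p hp
        exact hbd p.1 p.2 (hspec _ hp.2)
      · apply ContinuousAt.continuousWithinAt
        refine ContinuousAt.mul (by fun_prop) (ContinuousAt.inv₀ (by fun_prop) ?_)
        exact hcontW z hz w hw
    · refine .of_forall fun z w hw => ?_
      by_cases hz : z ∈ tsupport (dbar Ftil)
      · simpa only [Set.indicator_of_mem hz] using hbd z w (hspec w hw)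
      · simp [Set.indicator_of_notMem hz, image_eq_zero_of_notMem_tsupport hz]
    · have : IntegrableOn (fun z : ℂ => C * |z.im|) (tsupport (dbar Ftil)) :=
        Continuous.continuousOn (by fun_prop) |>.integrableOn_compact hdsupp.isCompact
      exact (this.integrable_indicator hdsupp.isCompact.measurableSet).2
    · exact hB.isStarNormal
  have hright : ∀ z : ℂ, cfc (fun w : ℂ => dbar Ftil z * (w - z)⁻¹) B
      = dbar Ftil z • Ring.inverse (B - z • 1) := by
    intro z
    have hn : IsStarNormal B := hB.isStarNormal
    by_cases hz : z.im = 0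
    · simp [hd0 z hz]
    · have hc : ContinuousOn (fun w : ℂ => (w - z)⁻¹) (spectrum ℂ B) :=
        ContinuousOn.inv₀ (by fun_prop) (hcontW z hz)
      rw [cfc_const_mul _ _ _ hc, cfc_inv (fun w : ℂ => w - z) B (hcontW z hz),
        cfc_sub (fun w : ℂ => w) (fun _ => z) B, cfc_id' ℂ B, cfc_const z B,
        Algebra.algebraMap_eq_smul_one]
  simp only [hright] at key
  rw [← key]
  have hn : IsStarNormal B := hB.isStarNormal
  have h3 : cfc (fun w : ℂ => ∫ z : ℂ, dbar Ftil z * (w - z)⁻¹) B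
      = cfc (fun w : ℂ => (Real.pi : ℂ) * F w.re) B := by
    refine cfc_congr fun w hw => ?_
    have : w = (w.re : ℂ) := by
      apply Complex.ext <;> simp [hspec w hw]
    rw [pompeiu Ftil hC1 hFtsupp w, ← hext, ← this]
  have hFc : Continuous F := hF.continuous
  rw [h3, cfc_const_mul _ _ _ (by fun_prop), ← Complex.coe_smul, smul_smul]
  have : (((Real.pi)⁻¹ : ℝ) : ℂ) * (Real.pi : ℂ) = 1 := by
    have := Real.pi_ne_zero
    rw [← Complex.ofReal_mul, inv_mul_cancel₀ this, Complex.ofReal_one]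
  rw [this, one_smul]
end

section
/- Commutator expansion formula (bounded version): Let 𝓗 be a complex Hilbert space, B and H bounded self-adjoint operators on 𝓗, F : ℝ → ℂ a compactly supported smooth function, and F̃ an almost analytic extension of F. Then i[H, F(B)] = -π^{-1} ∫_ℂ (∂̄F̃)(z) (B - z)^{-1} (i[H, B]) (B - z)^{-1} du dv, where [S, T] = ST - TS. -/
open MeasureTheory

noncomputable def eU (θ : ℝ) : ℂ := (Real.cos θ : ℂ) + (Real.sin θ : ℂ) * Complex.I

lemma continuous_eU : Continuous eU := by unfold eU; fun_prop

lemma norm_eU (θ : ℝ) : ‖eU θ‖ = 1 := by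
  unfold eU; push_cast; exact Complex.norm_cos_add_sin_mul_I θ

lemma hasDerivAt_eU (θ : ℝ) : HasDerivAt eU (Complex.I * eU θ) θ := by
  have h1 : HasDerivAt (fun t : ℝ => ((Real.cos t : ℝ) : ℂ)) ((-Real.sin θ : ℝ) : ℂ) θ :=
    (Real.hasDerivAt_cos θ).ofReal_comp
  have h2 : HasDerivAt (fun t : ℝ => ((Real.sin t : ℝ) : ℂ)) ((Real.cos θ : ℝ) : ℂ) θ :=
    (Real.hasDerivAt_sin θ).ofReal_comp
  refine (h1.add (h2.mul_const Complex.I)).congr_deriv ?_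
  unfold eU
  push_cast
  linear_combination (-Complex.sin θ) * Complex.I_mul_I

lemma integrableOn_polar (φ : ℝ × ℝ → ℂ) (hφ : Continuous φ) (R : ℝ)
    (h0 : ∀ r θ : ℝ, R < r → φ (r, θ) = 0) :
    IntegrableOn φ (Set.Ioi (0 : ℝ) ×ˢ Set.Ioo (-Real.pi) Real.pi) volume := by
  have h1 : IntegrableOn φ (Set.Icc (0 : ℝ) R ×ˢ Set.Icc (-Real.pi) Real.pi) volume :=
    hφ.continuousOn.integrableOn_compact (isCompact_Icc.prod isCompact_Icc)
  refine h1.of_forall_sdiff_eq_zero (measurableSet_Ioi.prod measurableSet_Ioo) ?_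
  rintro ⟨r, θ⟩ ⟨⟨hr, hθ⟩, hn⟩
  apply h0
  by_contra hc
  exact hn ⟨⟨le_of_lt hr, not_lt.mp hc⟩, ⟨hθ.1.le, hθ.2.le⟩⟩

lemma cauchy_pompeiu_zero (g : ℂ → ℂ) (hg : ContDiff ℝ (⊤ : ℕ∞) g) (hs : HasCompactSupport g) :
    ∫ z : ℂ, dbar g z * z⁻¹ = -(Real.pi : ℂ) * g 0 := by
  have hg1 : ContDiff ℝ 1 g := hg.of_le (by norm_cast)
  have hdiff : Differentiable ℝ g := hg1.differentiable (by norm_num)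
  have hDc : Continuous (fderiv ℝ g) := hg1.continuous_fderiv (by norm_num)
  have hDs : HasCompactSupport (fderiv ℝ g) := hs.fderiv (𝕜 := ℝ)
  obtain ⟨R, hR⟩ := hDs.isCompact.isBounded.subset_closedBall (0 : ℂ)
  obtain ⟨R', hR'⟩ := hs.isCompact.isBounded.subset_closedBall (0 : ℂ)
  have hD0 : ∀ r θ : ℝ, max R 0 < r → fderiv ℝ g ((r : ℂ) * eU θ) = 0 := by
    intro r θ hr
    by_contra hc
    have := hR (subset_tsupport _ hc)
    rw [mem_closedBall_zero_iff, norm_mul, norm_eU, mul_one, Complex.norm_real, Real.norm_eq_abs]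
      at this
    linarith [le_max_left R 0, le_abs_self r]
  have hg0 : ∀ r θ : ℝ, max R' 0 < r → g ((r : ℂ) * eU θ) = 0 := by
    intro r θ hr
    by_contra hc
    have := hR' (subset_tsupport _ hc)
    rw [mem_closedBall_zero_iff, norm_mul, norm_eU, mul_one, Complex.norm_real, Real.norm_eq_abs]
      at this
    linarith [le_max_left R' 0, le_abs_self r]
  set a : ℝ × ℝ → ℂ := fun p => fderiv ℝ g ((p.1 : ℂ) * eU p.2) (eU p.2) with ha
  set b : ℝ × ℝ → ℂ := fun p => fderiv ℝ g ((p.1 : ℂ) * eU p.2) (Complex.I * eU p.2) with hb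
  have heU2 : Continuous fun p : ℝ × ℝ => eU p.2 := continuous_eU.comp continuous_snd
  have hP : Continuous fun p : ℝ × ℝ => (p.1 : ℂ) * eU p.2 :=
    (Complex.continuous_ofReal.comp continuous_fst).mul heU2
  have hac : Continuous a := (hDc.comp hP).clm_apply heU2
  have hbc : Continuous b := (hDc.comp hP).clm_apply (continuous_const.mul heU2)
  have hai := integrableOn_polar a hac (max R 0) (fun r θ h => by simp [ha, hD0 r θ h])
  have hbi := integrableOn_polar b hbc (max R 0) (fun r θ h => by simp [hb, hD0 r θ h])
  have hIa : ∫ p in Set.Ioi (0 : ℝ) ×ˢ Set.Ioo (-Real.pi) Real.pi, a p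
      = -(2 * Real.pi : ℂ) * g 0 := by
    rw [Measure.volume_eq_prod, ← setIntegral_prod_swap, setIntegral_prod]
    · have : ∀ θ : ℝ, ∫ r in Set.Ioi (0 : ℝ), a (r, θ) = - g 0 := by
        intro θ
        have hd : ∀ r : ℝ, HasDerivAt (fun r : ℝ => g ((r : ℂ) * eU θ)) (a (r, θ)) r := by
          intro r
          have h1 : HasDerivAt (fun r : ℝ => (r : ℂ) * eU θ) (eU θ) r := by
            simpa using (Complex.ofRealCLM.hasDerivAt (x := r)).mul_const (eU θ)
          exact (hdiff _).hasFDerivAt.comp_hasDerivAt r h1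
        have hi : IntegrableOn (fun r => a (r, θ)) (Set.Ioi 0) := by
          have h1 : IntegrableOn (fun r => a (r, θ)) (Set.Icc (0 : ℝ) (max R 0)) volume :=
            (hac.comp (by fun_prop : Continuous fun r : ℝ => (r, θ))).continuousOn.integrableOn_compact
              isCompact_Icc
          refine h1.of_forall_sdiff_eq_zero measurableSet_Ioi ?_
          rintro r ⟨hr, hn⟩
          have : max R 0 < r := by
            by_contra hc
            exact hn ⟨le_of_lt hr, not_lt.mp hc⟩
          simp [ha, hD0 r θ this]
        have ht : Filter.Tendsto (fun r : ℝ => g ((r : ℂ) * eU θ)) Filter.atTop (nhds 0) := by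
          refine tendsto_const_nhds.congr' ?_
          filter_upwards [Filter.eventually_gt_atTop (max R' 0)] with r hr
          exact (hg0 r θ hr).symm
        rw [integral_Ioi_of_hasDerivAt_of_tendsto' (fun r _ => hd r) hi ht]
        simp
      simp only [Prod.swap, this]
      rw [setIntegral_const]
      simp [Real.pi_pos.le, measureReal_def]
      left; ring
    · exact hai.swap
  have hIb : ∫ p in Set.Ioi (0 : ℝ) ×ˢ Set.Ioo (-Real.pi) Real.pi, b p = 0 := by
    rw [Measure.volume_eq_prod, setIntegral_prod _ hbi]
    rw [setIntegral_congr_fun (g := fun _ => (0 : ℂ)) measurableSet_Ioi, integral_zero]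
    intro r hr
    have hr : (0 : ℝ) < r := hr
    show ∫ θ in Set.Ioo (-Real.pi) Real.pi, b (r, θ) = 0
    rw [← integral_Ioc_eq_integral_Ioo, ← intervalIntegral.integral_of_le (by linarith [Real.pi_pos])]
    have hd : ∀ θ : ℝ, HasDerivAt (fun θ : ℝ => g ((r : ℂ) * eU θ)) ((r : ℂ) * b (r, θ)) θ := by
      intro θ
      have h1 : HasDerivAt (fun θ : ℝ => (r : ℂ) * eU θ) ((r : ℂ) * (Complex.I * eU θ)) θ :=
        (hasDerivAt_eU θ).const_mul _
      refine ((hdiff _).hasFDerivAt.comp_hasDerivAt θ h1).congr_deriv ?_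
      rw [← Complex.real_smul (x := r) (z := Complex.I * eU θ), map_smul, Complex.real_smul]
    have hbr : Continuous fun θ : ℝ => b (r, θ) := hbc.comp (by fun_prop)
    have h2 := intervalIntegral.integral_eq_sub_of_hasDerivAt (a := -Real.pi) (b := Real.pi)
      (fun θ _ => hd θ) ((continuous_const.mul hbr).intervalIntegrable _ _)
    rw [intervalIntegral.integral_const_mul] at h2
    have h3 : eU Real.pi = eU (-Real.pi) := by simp [eU]
    rw [h3, sub_self] at h2
    exact (mul_eq_zero.mp h2).resolve_left (by exact_mod_cast hr.ne')
  rw [← Complex.integral_comp_polarCoord_symm]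
  have hpt : ∀ p ∈ polarCoord.target, p.1 • (dbar g (Complex.polarCoord.symm p) *
      (Complex.polarCoord.symm p)⁻¹) = (1 / 2 : ℂ) * (a p + Complex.I * b p) := by
    rintro ⟨r, θ⟩ ⟨hr, hθ⟩
    have hr : (0 : ℝ) < r := hr
    have hrc : (r : ℂ) ≠ 0 := by exact_mod_cast hr.ne'
    have he : Complex.polarCoord.symm (r, θ) = (r : ℂ) * eU θ := by
      rw [Complex.polarCoord_symm_apply]; rfl
    rw [he]
    simp only [ha, hb, dbar]
    set D := fderiv ℝ g ((r : ℂ) * eU θ)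
    have hcs : (Real.cos θ : ℂ) ^ 2 + (Real.sin θ : ℂ) ^ 2 = 1 := by
      exact_mod_cast Real.cos_sq_add_sin_sq θ
    have e1 : eU θ = Real.cos θ • (1 : ℂ) + Real.sin θ • Complex.I := by
      simp [eU]
    have e2 : Complex.I * eU θ = (-Real.sin θ) • (1 : ℂ) + Real.cos θ • Complex.I := by
      simp only [eU, Complex.real_smul]; push_cast
      linear_combination (Complex.sin θ) * Complex.I_mul_I
    have d1 : D (eU θ) = Real.cos θ * D 1 + Real.sin θ * D Complex.I := by
      rw [e1, map_add, map_smul, map_smul]; simp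
    have d2 : D (Complex.I * eU θ) = -Real.sin θ * D 1 + Real.cos θ * D Complex.I := by
      rw [e2, map_add, map_smul, map_smul]; simp
    have hinv : (eU θ)⁻¹ = Real.cos θ - Real.sin θ * Complex.I := by
      refine inv_eq_of_mul_eq_one_right ?_
      unfold eU
      linear_combination hcs - (Real.sin θ : ℂ) ^ 2 * Complex.I_mul_I
    rw [mul_inv, hinv, Complex.real_smul, d1, d2]
    field_simp
    linear_combination (-(Real.sin θ : ℂ) * D Complex.I) * Complex.I_mul_I
  rw [setIntegral_congr_fun polarCoord.open_target.measurableSet hpt, integral_const_mul]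
  change (1 / 2 : ℂ) * ∫ p in Set.Ioi (0 : ℝ) ×ˢ Set.Ioo (-Real.pi) Real.pi, (a p + Complex.I * b p) = _
  rw [integral_add hai (hbi.const_mul _), integral_const_mul, hIa, hIb]
  ring

lemma cauchy_pompeiu (f : ℂ → ℂ) (hf : ContDiff ℝ (⊤ : ℕ∞) f) (hs : HasCompactSupport f) (w : ℂ) :
    ∫ z : ℂ, dbar f z * (w - z)⁻¹ = (Real.pi : ℂ) * f w := by
  have h := cauchy_pompeiu_zero (fun z => f (z + w)) (hf.comp (by fun_prop))
    (hs.comp_homeomorph (Homeomorph.addRight w))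
  rw [← integral_add_right_eq_self _ w]
  have : ∀ z, dbar f (z + w) * (w - (z + w))⁻¹ = -(dbar (fun z => f (z + w)) z * z⁻¹) := by
    intro z
    simp only [dbar, fderiv_comp_add_right]
    rw [show w - (z + w) = -z by ring, inv_neg]; ring
  simp only [this]
  rw [integral_neg, h]; simp

lemma kernel_bound (f : ℂ → ℂ) (k : ℕ) (C : ℝ) (hC : ∀ z : ℂ, ‖dbar f z‖ ≤ C * |z.im| ^ (k + 1))
    (z : ℂ) (x : ℝ) : ‖dbar f z * ((x : ℂ) - z)⁻¹‖ ≤ C * |z.im| ^ k := by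
  have hC0 : 0 ≤ C := by
    have := (norm_nonneg _).trans (hC Complex.I)
    simpa using this
  by_cases hz : z.im = 0
  · have : dbar f z = 0 := by
      have := hC z
      rw [hz] at this
      simpa using this
    rw [this, zero_mul, norm_zero]; positivity
  · have hz' : 0 < |z.im| := abs_pos.mpr hz
    have h1 : |z.im| ≤ ‖(x : ℂ) - z‖ := by
      have := Complex.abs_im_le_norm ((x : ℂ) - z)
      simpa using this
    rw [norm_mul, norm_inv, ← div_eq_mul_inv, div_le_iff₀ (hz'.trans_le h1)]
    calc ‖dbar f z‖ ≤ C * |z.im| ^ k * |z.im| := by rw [mul_assoc, ← pow_succ]; exact hC z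
      _ ≤ _ := by gcongr

lemma continuous_dbar (f : ℂ → ℂ) (hf : ContDiff ℝ (⊤ : ℕ∞) f) : Continuous (dbar f) := by
  have hf1 : ContDiff ℝ 1 f := hf.of_le (by norm_cast)
  have hDc : Continuous (fderiv ℝ f) := hf1.continuous_fderiv (by norm_num)
  unfold dbar
  fun_prop

lemma continuous_kernel (f : ℂ → ℂ) (hf : ContDiff ℝ (⊤ : ℕ∞) f)
    (haa : ∀ k : ℕ, ∃ C : ℝ, ∀ z : ℂ, ‖dbar f z‖ ≤ C * |z.im| ^ k) :
    Continuous (fun p : ℂ × ℂ => dbar f p.1 * ((p.2.re : ℂ) - p.1)⁻¹) := by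
  rw [continuous_iff_continuousAt]
  rintro ⟨z, r⟩
  by_cases hz : z.im = 0
  · obtain ⟨C, hC⟩ := haa 2
    have hb := kernel_bound f 1 C hC
    have h0 : dbar f z * ((r.re : ℂ) - z)⁻¹ = 0 := by
      have := hb z r.re
      rw [hz, abs_zero, pow_one, mul_zero] at this
      exact norm_le_zero_iff.mp this
    rw [ContinuousAt]
    simp only [h0]
    refine squeeze_zero_norm (fun p : ℂ × ℂ => hb p.1 p.2.re) ?_
    have : Continuous fun p : ℂ × ℂ => C * |p.1.im| ^ 1 :=
      continuous_const.mul (((Complex.continuous_im.comp continuous_fst).abs).pow 1)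
    have h := this.tendsto (z, r)
    simpa [hz] using h
  · refine ContinuousAt.mul ((continuous_dbar f hf).comp continuous_fst).continuousAt ?_
    refine ContinuousAt.inv₀ (Continuous.continuousAt ?_) ?_
    · exact (Complex.continuous_ofReal.comp (Complex.continuous_re.comp continuous_snd)).sub
        continuous_fst
    · intro h
      apply hz
      have := congrArg Complex.im h
      simpa using this

/-- **commutator expansion formula, bounded version.** For bounded self-adjoint
operators `B, H` on a complex Hilbert space, a compactly supported smooth `F : ℝ → ℂ` and an
almost analytic extension `F̃` of `F`,
`i[H, F(B)] = -π⁻¹ ∫_ℂ (∂̄F̃)(z) (B - z)⁻¹ (i[H, B]) (B - z)⁻¹ du dv`,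
where `[S, T] = S T - T S`. -/
theorem commutator_expansion_bounded
    {𝓗 : Type*} [NormedAddCommGroup 𝓗] [InnerProductSpace ℂ 𝓗] [CompleteSpace 𝓗]
    (B H : 𝓗 →L[ℂ] 𝓗) (hB : IsSelfAdjoint B) (hH : IsSelfAdjoint H)
    (F : ℝ → ℂ) (hF : ContDiff ℝ (⊤ : ℕ∞) F) (hFsupp : HasCompactSupport F)
    (Ftil : ℂ → ℂ) (hFt : ContDiff ℝ (⊤ : ℕ∞) Ftil) (hFtsupp : HasCompactSupport Ftil)
    (hext : ∀ x : ℝ, Ftil (x : ℂ) = F x)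
    (haa : ∀ k : ℕ, ∃ C : ℝ, ∀ z : ℂ, ‖dbar Ftil z‖ ≤ C * |z.im| ^ k) :
    Complex.I • (H * cfc (fun z : ℂ => F z.re) B - cfc (fun z : ℂ => F z.re) B * H) =
      -(Real.pi)⁻¹ • ∫ z : ℂ, (dbar Ftil z) •
        (Ring.inverse (B - z • 1) * (Complex.I • (H * B - B * H)) *
          Ring.inverse (B - z • 1)) := by
  have hN : IsStarNormal B := hB.isStarNormal
  set K : ℂ → ℂ → ℂ := fun z r => dbar Ftil z * ((r.re : ℂ) - z)⁻¹ with hK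
  have hKc : Continuous (Function.uncurry K) := continuous_kernel Ftil hFt haa
  obtain ⟨C, hC⟩ := haa 1
  have hDs : HasCompactSupport (fderiv ℝ Ftil) := hFtsupp.fderiv (𝕜 := ℝ)
  set S := tsupport (fderiv ℝ Ftil)
  have hS : IsCompact S := hDs
  set bound : ℂ → ℝ := S.indicator (fun _ => C) with hbound
  have hbi : HasFiniteIntegral bound volume :=
    ((integrable_indicator_iff hS.measurableSet).mpr
      (integrableOn_const hS.measure_lt_top.ne)).hasFiniteIntegral
  have hbge : ∀ᵐ z : ℂ, ∀ r ∈ spectrum ℂ B, ‖K z r‖ ≤ bound z := by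
    refine .of_forall fun z r _ => ?_
    by_cases hz : z ∈ S
    · rw [hbound, Set.indicator_of_mem hz]
      have := kernel_bound Ftil 0 C hC z r.re
      rwa [pow_zero, mul_one] at this
    · rw [hbound, Set.indicator_of_notMem hz]
      have : fderiv ℝ Ftil z = 0 := image_eq_zero_of_notMem_tsupport hz
      simp [hK, dbar, this]
  have hint := integrable_cfc (μ := volume) K bound B hKc.continuousOn hbge hbi hN
  have hcfc := cfc_integral (μ := volume) K bound B hKc.continuousOn hbge hbi hN
  have hunit : ∀ z : ℂ, z.im ≠ 0 → IsUnit (B - z • (1 : 𝓗 →L[ℂ] 𝓗)) := by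
    intro z hz
    have h1 : z ∉ spectrum ℂ B := by
      intro h
      have := hB.mem_spectrum_eq_re h
      apply hz
      rw [this]; simp
    rw [spectrum.notMem_iff, Algebra.algebraMap_eq_smul_one] at h1
    rw [← neg_sub]; exact h1.neg
  have hres : ∀ z : ℂ, cfc (K z) B = dbar Ftil z • Ring.inverse (B - z • 1) := by
    intro z
    by_cases hz : z.im = 0
    · have h0 : dbar Ftil z = 0 := by
        have := hC z
        rw [hz] at this
        simpa using this
      simp [hK, h0]
    · have hne : ∀ x ∈ spectrum ℂ B, x - z ≠ 0 := by
        intro x hx h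
        have h1 := hB.mem_spectrum_eq_re hx
        have h2 := congrArg Complex.im h
        rw [h1] at h2
        apply hz
        simpa using h2
      have hcont : ContinuousOn (fun x : ℂ => (x - z)⁻¹) (spectrum ℂ B) :=
        ContinuousOn.inv₀ (by fun_prop) hne
      have h1 : cfc (K z) B = cfc (fun x : ℂ => dbar Ftil z • (x - z)⁻¹) B := by
        refine cfc_congr fun x hx => ?_
        have h1 := hB.mem_spectrum_eq_re hx
        simp only [hK, smul_eq_mul]
        rw [← h1]
      rw [h1, cfc_smul _ _ _ hcont, cfc_inv (fun x : ℂ => x - z) B hne,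
        cfc_sub (fun x : ℂ => x) (fun _ => z) B, cfc_id' ℂ B, cfc_const z B,
        Algebra.algebraMap_eq_smul_one]
  have hFB : cfc (fun z : ℂ => F z.re) B = (Real.pi)⁻¹ • ∫ z : ℂ, cfc (K z) B := by
    have hpi : (Real.pi : ℂ) ≠ 0 := by exact_mod_cast Real.pi_ne_zero
    have h1 : (fun r : ℂ => ∫ z, K z r) = fun r => (Real.pi : ℂ) • F r.re := by
      funext r
      simp only [hK]
      rw [cauchy_pompeiu Ftil hFt hFtsupp, hext, smul_eq_mul]
    rw [← hcfc, h1, cfc_smul _ (fun r : ℂ => F r.re) _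
      (hF.continuous.comp Complex.continuous_re).continuousOn, ← Complex.coe_smul, smul_smul]
    push_cast
    rw [inv_mul_cancel₀ hpi, one_smul]
  rw [hFB, mul_smul_comm, smul_mul_assoc, ← smul_sub, neg_smul, ← smul_neg, smul_comm]
  congr 1
  rw [← integral_const_mul_of_integrable hint, ← integral_mul_const_of_integrable hint,
    ← integral_sub (hint.const_mul H) (hint.mul_const H), ← integral_smul, ← integral_neg]
  congr 1
  funext z
  rw [hres]
  by_cases hz : z.im = 0
  · have h0 : dbar Ftil z = 0 := by
      have := hC z
      rw [hz] at this
      simpa using this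
    simp [h0]
  · obtain ⟨u, hu⟩ := hunit z hz
    have hcomm : H * B - B * H = H * (u : 𝓗 →L[ℂ] 𝓗) - u * H := by
      rw [hu]; simp [mul_sub, sub_mul]
    rw [hcomm, ← hu, Ring.inverse_unit]
    rw [mul_smul_comm, smul_mul_assoc, ← smul_sub, smul_comm, mul_smul_comm, smul_mul_assoc,
      ← smul_neg, ← smul_neg]
    congr 2
    rw [mul_sub, sub_mul, mul_assoc, mul_assoc, Units.mul_inv, ← mul_assoc (↑u⁻¹ : 𝓗 →L[ℂ] 𝓗) (u : 𝓗 →L[ℂ] 𝓗),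
      Units.inv_mul]
    simp
end
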